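/- arXiv:2507.11850 — 4 statements merged into one kernel-verified Lean document; each statement's English description precedes it below -/
import Mathlib

section
/- Under the flotation setup, the buoyancy curve r₂ is twice differentiable and its oriented curvature κ₂(s) = det(r₂'(s), r₂''(s)) / |r₂'(s)|³ is given by κ₂(s) = 12δ / |c(s)|³ for every s (the Third Theorem of Dupin on the plane: the curvature of the curve of buoyancy equals 12δ divided by the cube of the length of the corresponding chord of flotation). -/
open Real MeasureTheory intervalIntegral

noncomputable section

/-- The Euclidean plane. -/
abbrev R2 := EuclideanSpace ℝ (Fin 2)

/-- The planar determinant `det(u,v) = u₁v₂ − u₂v₁`. -/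
def det2 (u v : R2) : ℝ := u 0 * v 1 - u 1 * v 0

/-- The flotation curve `r₁(s) = (γ(s) + γ(t(s)))/2`. -/
def flotCurve (γ : ℝ → R2) (t : ℝ → ℝ) (s : ℝ) : R2 := ((1:ℝ)/2) • (γ s + γ (t s))

/-- The buoyancy (centroid) curve
`r₂(s) = γ(s) + (1/(3δ))·∫_s^{t(s)} det(γ(u) − γ(s), γ'(u))·(γ(u) − γ(s)) du`. -/
def buoyCurve (γ : ℝ → R2) (t : ℝ → ℝ) (δ : ℝ) (s : ℝ) : R2 :=
  γ s + (1/(3*δ)) • ∫ u in s..t s, det2 (γ u - γ s) (deriv γ u) • (γ u - γ s)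

/-- The fundamental theorem of calculus with both endpoints moving. -/
lemma hasDerivAt_integral_moving {f t : ℝ → ℝ} {s t' : ℝ} (hf : Continuous f)
    (ht : HasDerivAt t t' s) :
    HasDerivAt (fun s => ∫ u in s..t s, f u) (f (t s) * t' - f s) s := by
  have h : ∀ r, HasDerivAt (fun r => ∫ u in (0:ℝ)..r, f u) (f r) r := fun r =>
    intervalIntegral.integral_hasDerivAt_right (hf.intervalIntegrable _ _)
      hf.stronglyMeasurable.stronglyMeasurableAtFilter hf.continuousAt
  refine (((h (t s)).comp s ht).sub (h s)).congr_of_eventuallyEq (.of_forall fun r => ?_)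
  exact (intervalIntegral.integral_interval_sub_left (hf.intervalIntegrable _ _) (hf.intervalIntegrable _ _)).symm

section Coordinates

variable {x y x' y' : ℝ → ℝ}

lemma integral_mul_deriv_by_parts (hx : ∀ u, HasDerivAt x (x' u) u) (hy : ∀ u, HasDerivAt y (y' u) u)
    (hx' : Continuous x') (hy' : Continuous y') (a b : ℝ) :
    ∫ u in a..b, y u * x' u = x b * y b - x a * y a - ∫ u in a..b, x u * y' u := by
  have hxc : Continuous x := continuous_iff_continuousAt.2 fun u => (hx u).continuousAt
  have hyc : Continuous y := continuous_iff_continuousAt.2 fun u => (hy u).continuousAt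
  rw [intervalIntegral.integral_mul_deriv_eq_deriv_mul (fun u _ => hy u) (fun u _ => hx u)
    (hy'.intervalIntegrable _ _) (hx'.intervalIntegrable _ _)]
  simp only [mul_comm]

/-- The area integral in terms of the integral of `x dy`. -/
lemma integral_area_eq (hx : ∀ u, HasDerivAt x (x' u) u) (hy : ∀ u, HasDerivAt y (y' u) u)
    (hx' : Continuous x') (hy' : Continuous y') (a b : ℝ) :
    ∫ u in a..b, ((x u - x a) * y' u - (y u - y a) * x' u) =
      2 * (∫ u in a..b, x u * y' u) - (x b * y b - x a * y a)
        - x a * (y b - y a) + y a * (x b - x a) := by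
  have hxc : Continuous x := continuous_iff_continuousAt.2 fun u => (hx u).continuousAt
  have hyc : Continuous y := continuous_iff_continuousAt.2 fun u => (hy u).continuousAt
  have e : ∀ u, (x u - x a) * y' u - (y u - y a) * x' u =
      x u * y' u - y u * x' u - x a * y' u + y a * x' u := fun u => by ring
  have i1 : IntervalIntegrable (fun u => x u * y' u) volume a b :=
    (hxc.mul hy').intervalIntegrable _ _
  have i2 : IntervalIntegrable (fun u => y u * x' u) volume a b :=
    (hyc.mul hx').intervalIntegrable _ _
  have i3 : IntervalIntegrable (fun u => x a * y' u) volume a b :=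
    (continuous_const.mul hy').intervalIntegrable _ _
  have i4 : IntervalIntegrable (fun u => y a * x' u) volume a b :=
    (continuous_const.mul hx').intervalIntegrable _ _
  simp only [e]
  rw [intervalIntegral.integral_add ((i1.sub i2).sub i3) i4, intervalIntegral.integral_sub (i1.sub i2) i3, intervalIntegral.integral_sub i1 i2,
    intervalIntegral.integral_const_mul, intervalIntegral.integral_const_mul, integral_mul_deriv_by_parts hx hy hx' hy',
    intervalIntegral.integral_eq_sub_of_hasDerivAt (fun u _ => hx u) (hx'.intervalIntegrable _ _),
    intervalIntegral.integral_eq_sub_of_hasDerivAt (fun u _ => hy u) (hy'.intervalIntegrable _ _)]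
  ring

/-- The first moment of area in terms of integrals with integrand independent of the endpoints. -/
lemma integral_moment_eq (hx : ∀ u, HasDerivAt x (x' u) u) (hy : ∀ u, HasDerivAt y (y' u) u)
    (hx' : Continuous x') (hy' : Continuous y') (a b : ℝ) :
    ∫ u in a..b, ((x u - x a) * y' u - (y u - y a) * x' u) * (x u - x a) =
      (∫ u in a..b, (x u * y' u - y u * x' u) * x u) - x a * (∫ u in a..b, x u * y' u)
        + y a * ((x b ^ 2 - x a ^ 2) / 2)
        - x a * ∫ u in a..b, ((x u - x a) * y' u - (y u - y a) * x' u) := by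
  have hxc : Continuous x := continuous_iff_continuousAt.2 fun u => (hx u).continuousAt
  have hyc : Continuous y := continuous_iff_continuousAt.2 fun u => (hy u).continuousAt
  have e : ∀ u, ((x u - x a) * y' u - (y u - y a) * x' u) * (x u - x a) =
      (x u * y' u - y u * x' u) * x u - x a * (x u * y' u) + y a * (x u * x' u)
        - x a * ((x u - x a) * y' u - (y u - y a) * x' u) := fun u => by ring
  have i1 : IntervalIntegrable (fun u => (x u * y' u - y u * x' u) * x u) volume a b :=
    (by fun_prop : Continuous _).intervalIntegrable _ _
  have i2 : IntervalIntegrable (fun u => x a * (x u * y' u)) volume a b :=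
    (by fun_prop : Continuous _).intervalIntegrable _ _
  have i3 : IntervalIntegrable (fun u => y a * (x u * x' u)) volume a b :=
    (by fun_prop : Continuous _).intervalIntegrable _ _
  have i4 : IntervalIntegrable (fun u => x a * ((x u - x a) * y' u - (y u - y a) * x' u))
      volume a b := (by fun_prop : Continuous _).intervalIntegrable _ _
  have hsq := integral_mul_deriv_by_parts hx hx hx' hx' a b
  simp only [e]
  rw [intervalIntegral.integral_sub ((i1.sub i2).add i3) i4, intervalIntegral.integral_add (i1.sub i2) i3, intervalIntegral.integral_sub i1 i2,
    intervalIntegral.integral_const_mul, intervalIntegral.integral_const_mul, intervalIntegral.integral_const_mul]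
  linear_combination (y a / 2) * hsq

variable {t' s D : ℝ} {t : ℝ → ℝ}

/-- Differentiating the condition that the cut-off area is constant. -/
lemma chord_relation (hx : ∀ u, HasDerivAt x (x' u) u) (hy : ∀ u, HasDerivAt y (y' u) u)
    (hx' : Continuous x') (hy' : Continuous y') (ht : HasDerivAt t t' s)
    (hA : ∀ s, ∫ u in s..t s, ((x u - x s) * y' u - (y u - y s) * x' u) = D) :
    ((x (t s) - x s) * y' (t s) - (y (t s) - y s) * x' (t s)) * t' =
      x' s * (y (t s) - y s) - y' s * (x (t s) - x s) := by
  have hxc : Continuous x := continuous_iff_continuousAt.2 fun u => (hx u).continuousAt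
  have hJ := hasDerivAt_integral_moving (hxc.mul hy') ht
  have hxt := (hx (t s)).comp s ht
  have hyt := (hy (t s)).comp s ht
  have h := ((((hJ.const_mul 2).sub ((hxt.mul hyt).sub ((hx s).mul (hy s)))).sub
    ((hx s).mul (hyt.sub (hy s)))).add ((hy s).mul (hxt.sub (hx s)))).congr_of_eventuallyEq
    (.of_forall fun r => ((hA r).symm.trans (integral_area_eq hx hy hx' hy' r (t r))))
  have h0 := h.unique (hasDerivAt_const s D)
  simp only [Function.comp_apply, Pi.sub_apply, Pi.mul_apply] at h0
  linear_combination h0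

/-- The derivative of the first moment of the cut-off region. -/
lemma hasDerivAt_moment (hx : ∀ u, HasDerivAt x (x' u) u) (hy : ∀ u, HasDerivAt y (y' u) u)
    (hx' : Continuous x') (hy' : Continuous y') (ht : HasDerivAt t t' s)
    (hA : ∀ s, ∫ u in s..t s, ((x u - x s) * y' u - (y u - y s) * x' u) = D) :
    HasDerivAt
      (fun s => ∫ u in s..t s, ((x u - x s) * y' u - (y u - y s) * x' u) * (x u - x s))
      ((x' s * (y (t s) - y s) - y' s * (x (t s) - x s)) * (x (t s) - x s) / 2
        - 3 / 2 * D * x' s) s := by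
  have hxc : Continuous x := continuous_iff_continuousAt.2 fun u => (hx u).continuousAt
  have hyc : Continuous y := continuous_iff_continuousAt.2 fun u => (hy u).continuousAt
  have hJ := hasDerivAt_integral_moving (hxc.mul hy') ht
  have hQ := hasDerivAt_integral_moving (((hxc.mul hy').sub (hyc.mul hx')).mul hxc) ht
  have hxt := (hx (t s)).comp s ht
  have h := (((hQ.sub ((hx s).mul hJ)).add ((hy s).mul
    (((hxt.pow 2).sub ((hx s).pow 2)).div_const 2))).sub
    ((hx s).mul_const D)).congr_of_eventuallyEq
    (.of_forall fun r => ((integral_moment_eq hx hy hx' hy' r (t r)).trans (by rw [hA r]; rfl)))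
  refine h.congr_deriv ?_
  have hrel := chord_relation hx hy hx' hy' ht hA
  have hAs := (integral_area_eq hx hy hx' hy' s (t s)).symm.trans (hA s)
  simp only [Function.comp_apply, Pi.sub_apply, Pi.pow_apply, Pi.mul_apply]
  norm_num
  linear_combination x (t s) * hrel - x' s / 2 * hAs

end Coordinates

lemma hasDerivAt_R2_iff {f : ℝ → R2} {f' : R2} {s : ℝ} :
    HasDerivAt f f' s ↔
      HasDerivAt (fun u => f u 0) (f' 0) s ∧ HasDerivAt (fun u => f u 1) (f' 1) s := by
  constructor
  · intro h
    exact ⟨(EuclideanSpace.proj (𝕜 := ℝ) (0 : Fin 2)).hasFDerivAt.comp_hasDerivAt s h,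
      (EuclideanSpace.proj (𝕜 := ℝ) (1 : Fin 2)).hasFDerivAt.comp_hasDerivAt s h⟩
  · rintro ⟨h0, h1⟩
    have key : ∀ i, HasDerivAt (fun u => f u i) (f' i) s := fun i => by fin_cases i <;> assumption
    refine hasDerivAt_iff_hasFDerivAt.2 (hasFDerivWithinAt_univ.1
      (hasFDerivWithinAt_euclidean.2 fun i => hasFDerivWithinAt_univ.2 ?_))
    refine (key i).hasFDerivAt.congr_fderiv ?_
    ext
    simp

/-- The velocity of the buoyancy curve is parallel to the chord of flotation. -/
lemma hasDerivAt_buoyCurve {γ : ℝ → R2} (hγ : ContDiff ℝ 1 γ) {δ : ℝ} (hδ : δ ≠ 0) {t : ℝ → ℝ}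
    {s : ℝ} (ht : DifferentiableAt ℝ t s)
    (hA : ∀ s, (1/2) * ∫ u in s..t s, det2 (γ u - γ s) (deriv γ u) = δ) :
    HasDerivAt (buoyCurve γ t δ)
      ((det2 (deriv γ s) (γ (t s) - γ s) / (6 * δ)) • (γ (t s) - γ s)) s := by
  have hd : ∀ u, HasDerivAt γ (deriv γ u) u := fun u =>
    (hγ.differentiable (by norm_num) u).hasDerivAt
  have hc : Continuous (deriv γ) := hγ.continuous_deriv le_rfl
  have hγc := hγ.continuous
  have hx := fun u => (hasDerivAt_R2_iff.1 (hd u)).1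
  have hy := fun u => (hasDerivAt_R2_iff.1 (hd u)).2
  have hx' : Continuous fun u => deriv γ u 0 := by fun_prop
  have hy' : Continuous fun u => deriv γ u 1 := by fun_prop
  have hA0 : ∀ s, ∫ u in s..t s, ((γ u 0 - γ s 0) * deriv γ u 1 - (γ u 1 - γ s 1) * deriv γ u 0)
      = 2 * δ := fun s => by
    have := hA s
    simp only [det2, PiLp.sub_apply] at this
    linarith
  have hA1 : ∀ s, ∫ u in s..t s, ((γ u 1 - γ s 1) * deriv γ u 0 - (γ u 0 - γ s 0) * deriv γ u 1)
      = -(2 * δ) := fun s => by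
    rw [← hA0 s, ← intervalIntegral.integral_neg]
    simp only [neg_sub]
  have h0 := hasDerivAt_moment hx hy hx' hy' ht.hasDerivAt hA0
  have h1 := hasDerivAt_moment hy hx hy' hx' ht.hasDerivAt hA1
  have hcoord : ∀ i s, buoyCurve γ t δ s i = γ s i + 1 / (3 * δ) *
      ∫ u in s..t s, ((γ u 0 - γ s 0) * deriv γ u 1 - (γ u 1 - γ s 1) * deriv γ u 0) *
        (γ u i - γ s i) := fun i s => by
    have hi : IntervalIntegrable (fun u => det2 (γ u - γ s) (deriv γ u) • (γ u - γ s)) volume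
        s (t s) := by
      refine Continuous.intervalIntegrable ?_ _ _
      unfold det2
      fun_prop
    have := (EuclideanSpace.proj (𝕜 := ℝ) i).intervalIntegral_comp_comm hi
    simp only [PiLp.proj_apply, PiLp.smul_apply, smul_eq_mul, PiLp.sub_apply, det2]
      at this
    simp only [buoyCurve, PiLp.add_apply, PiLp.smul_apply, smul_eq_mul, det2, PiLp.sub_apply, this]
  refine hasDerivAt_R2_iff.2 ⟨?_, ?_⟩
  · simp only [hcoord]
    refine ((hx s).add (h0.const_mul (1 / (3 * δ)))).congr_deriv ?_
    simp only [PiLp.smul_apply, smul_eq_mul, det2, PiLp.sub_apply]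
    field_simp
    ring
  · simp only [hcoord]
    refine ((hy s).add (h1.neg.const_mul (1 / (3 * δ)))).congr_of_eventuallyEq
      (.of_forall fun r => ?_) |>.congr_deriv ?_
    · simp only [Pi.add_apply, Pi.neg_apply, ← intervalIntegral.integral_neg]
      congr 3 with u
      ring
    · simp only [PiLp.smul_apply, smul_eq_mul, det2, PiLp.sub_apply]
      field_simp
      ring

/-- A convex body lies on one side of each tangent line of its boundary curve. -/
lemma tangent_supports {γ : ℝ → R2} {K : Set R2} (hKconv : Convex ℝ K) (hKcl : IsClosed K)
    (hKint : (interior K).Nonempty) (hKbd : frontier K = Set.range γ) {s : ℝ}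
    (hd : DifferentiableAt ℝ γ s) (hreg : deriv γ s ≠ 0) :
    ∃ k : ℝ, k ≠ 0 ∧ ∀ p ∈ K, k * det2 (deriv γ s) (p - γ s) ≤ 0 := by
  have hs : γ s ∈ frontier K := hKbd ▸ Set.mem_range_self s
  obtain ⟨f, hf⟩ := geometric_hahn_banach_open_point hKconv.interior isOpen_interior hs.2
  have hle : ∀ p ∈ K, f p ≤ f (γ s) := by
    intro p hp
    have hcl : p ∈ closure (interior K) := by
      rw [hKconv.closure_interior_eq_closure_of_nonempty_interior hKint]
      exact subset_closure hp
    exact closure_minimal (fun a ha => (hf a ha).le)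
      (isClosed_le f.continuous continuous_const) hcl
  have hγK : ∀ u, γ u ∈ K := fun u => hKcl.frontier_subset (hKbd ▸ Set.mem_range_self u)
  have hmax : IsLocalMax (fun u => f (γ u)) s := .of_forall fun u => hle _ (hγK u)
  have hz : f (deriv γ s) = 0 :=
    hmax.hasDerivAt_eq_zero (f.hasFDerivAt.comp_hasDerivAt s hd.hasDerivAt)
  set e0 : R2 := EuclideanSpace.single 0 1
  set e1 : R2 := EuclideanSpace.single 1 1
  have hcoord : ∀ v : R2, f v = v 0 * f e0 + v 1 * f e1 := fun v => by
    have hv : v = v 0 • e0 + v 1 • e1 := by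
      ext i; fin_cases i <;> simp [e0, e1]
    conv_lhs => rw [hv]
    simp
  obtain ⟨q, hq⟩ := hKint
  have hqlt := hf q hq
  set g := deriv γ s
  have hg : 0 < g 0 ^ 2 + g 1 ^ 2 := by
    by_contra! h
    refine hreg ?_
    ext i
    fin_cases i
    · simpa using (by nlinarith [sq_nonneg (g 0), sq_nonneg (g 1)] : g 0 ^ 2 = 0)
    · simpa using (by nlinarith [sq_nonneg (g 0), sq_nonneg (g 1)] : g 1 ^ 2 = 0)
  rw [hcoord] at hz
  have hdet : ∀ v, (g 0 * f e1 - g 1 * f e0) * det2 g v = (g 0 ^ 2 + g 1 ^ 2) * f v := fun v => by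
    rw [hcoord v, det2]
    linear_combination (-(g 0 * v 0) - g 1 * v 1) * hz
  refine ⟨g 0 * f e1 - g 1 * f e0, fun h => ?_, fun p hp => ?_⟩
  · have h2 := hdet (q - γ s)
    rw [h, zero_mul, map_sub] at h2
    rcases mul_eq_zero.1 h2.symm with h3 | h3 <;> linarith
  · rw [hdet, map_sub]
    exact mul_nonpos_of_nonneg_of_nonpos hg.le (sub_nonpos.2 (hle p hp))

/-- The area integral of a closed curve does not depend on the base point. -/
lemma integral_det2_sub_of_closed {γ : ℝ → R2} (hγ : ContDiff ℝ 1 γ) {a b : ℝ} (hab : γ b = γ a)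
    (p : R2) :
    ∫ u in a..b, det2 (γ u - p) (deriv γ u) = ∫ u in a..b, det2 (γ u) (deriv γ u) := by
  have hd : ∀ u, HasDerivAt γ (deriv γ u) u := fun u =>
    (hγ.differentiable (by norm_num) u).hasDerivAt
  have hc : Continuous (deriv γ) := hγ.continuous_deriv le_rfl
  have hγc := hγ.continuous
  have hp : ∫ u in a..b, det2 p (deriv γ u) = 0 := by
    have h := intervalIntegral.integral_eq_sub_of_hasDerivAt (a := a) (b := b)
      (f := fun u => det2 p (γ u)) (f' := fun u => det2 p (deriv γ u))
      (fun u _ => ((hasDerivAt_R2_iff.1 (hd u)).2.const_mul (p 0)).sub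
        ((hasDerivAt_R2_iff.1 (hd u)).1.const_mul (p 1)))
      (by unfold det2; exact (by fun_prop : Continuous _).intervalIntegrable _ _)
    rw [h, hab, sub_self]
  have e : ∀ u, det2 (γ u - p) (deriv γ u) = det2 (γ u) (deriv γ u) - det2 p (deriv γ u) :=
    fun u => by simp only [det2, PiLp.sub_apply]; ring
  simp only [e]
  rw [intervalIntegral.integral_sub, hp, sub_zero] <;>
  · unfold det2
    exact (by fun_prop : Continuous _).intervalIntegrable _ _

/-- Along a positively oriented boundary of a convex body, chords lie to the left of tangents. -/
lemma det2_deriv_chord_pos {γ : ℝ → R2} {L : ℝ} (hL : 0 < L) (hγ : ContDiff ℝ 1 γ)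
    (hclosed : γ L = γ 0) (hreg : ∀ s, deriv γ s ≠ 0)
    (hor : 0 < ∫ s in (0:ℝ)..L, det2 (γ s) (deriv γ s))
    {K : Set R2} (hKconv : Convex ℝ K) (hKcl : IsClosed K)
    (hKint : (interior K).Nonempty) (hKbd : frontier K = Set.range γ)
    {t : ℝ → ℝ} (ht : Continuous t) (hc : ∀ s, det2 (deriv γ s) (γ (t s) - γ s) ≠ 0) (s : ℝ) :
    0 < det2 (deriv γ s) (γ (t s) - γ s) := by
  have hcd : Continuous (deriv γ) := hγ.continuous_deriv le_rfl
  have hγc := hγ.continuous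
  have hcont : Continuous fun s => det2 (deriv γ s) (γ (t s) - γ s) := by
    unfold det2; fun_prop
  have hγK : ∀ u, γ u ∈ K := fun u => hKcl.frontier_subset (hKbd ▸ Set.mem_range_self u)
  by_contra! hneg
  have hall : ∀ r, det2 (deriv γ r) (γ (t r) - γ r) < 0 := by
    intro r
    by_contra! hr
    obtain ⟨z, hz⟩ := mem_range_of_exists_le_of_exists_ge hcont ⟨s, hneg⟩ ⟨r, hr⟩
    exact hc z hz
  have hside : ∀ r, det2 (γ r - γ 0) (deriv γ r) ≤ 0 := by
    intro r
    obtain ⟨k, hk, hsup⟩ := tangent_supports hKconv hKcl hKint hKbd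
      (hγ.differentiable (by norm_num) r) (hreg r)
    have hk0 : 0 < k := by
      refine lt_of_le_of_ne ?_ hk.symm
      by_contra! hk1
      exact absurd (hsup _ (hγK (t r))) (not_le.2 (mul_pos_of_neg_of_neg hk1 (hall r)))
    have h := nonpos_of_mul_nonpos_right (hsup _ (hγK 0)) hk0
    simp only [det2, PiLp.sub_apply] at h ⊢
    linarith
  rw [← integral_det2_sub_of_closed hγ hclosed (γ 0)] at hor
  refine absurd hor (not_lt.2 ?_)
  have h := intervalIntegral.integral_nonneg (μ := volume) hL.le
    (f := fun u => -det2 (γ u - γ 0) (deriv γ u)) fun u _ => neg_nonneg.2 (hside u)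
  rw [intervalIntegral.integral_neg] at h
  linarith

/-- the Third Theorem of Dupin on the plane. -/
theorem stmt3
    (γ : ℝ → R2) (L : ℝ) (hL : 0 < L)
    (hγ : ContDiff ℝ 2 γ)
    (hper : ∀ s, γ (s + L) = γ s)
    (hreg : ∀ s, deriv γ s ≠ 0)
    (hinj : Set.InjOn γ (Set.Ico 0 L))
    (hor : 0 < ∫ s in (0:ℝ)..L, det2 (γ s) (deriv γ s))
    (K : Set R2) (hKconv : Convex ℝ K) (hKcomp : IsCompact K)
    (hKint : (interior K).Nonempty) (hKbd : frontier K = Set.range γ)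
    (δ : ℝ) (hδ0 : 0 < δ) (hδK : δ < (volume K).toReal)
    (t : ℝ → ℝ) (ht : ContDiff ℝ 1 t)
    (htrange : ∀ s, s < t s ∧ t s < s + L)
    (hA : ∀ s, (1/2) * ∫ u in s..t s, det2 (γ u - γ s) (deriv γ u) = δ)
    (hc1 : ∀ s, det2 (γ (t s) - γ s) (deriv γ s) ≠ 0)
    (hc2 : ∀ s, det2 (γ (t s) - γ s) (deriv γ (t s)) ≠ 0) :
    ∀ s : ℝ,
      DifferentiableAt ℝ (buoyCurve γ t δ) s ∧
      DifferentiableAt ℝ (deriv (buoyCurve γ t δ)) s ∧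
      det2 (deriv (buoyCurve γ t δ) s) (deriv (deriv (buoyCurve γ t δ)) s) /
          ‖deriv (buoyCurve γ t δ) s‖ ^ 3 =
        12 * δ / ‖γ (t s) - γ s‖ ^ 3 := by
  have hγ1 : ContDiff ℝ 1 γ := hγ.of_le (by norm_num)
  have hswap : ∀ s, det2 (deriv γ s) (γ (t s) - γ s) = -det2 (γ (t s) - γ s) (deriv γ s) :=
    fun s => by simp only [det2]; ring
  have hpos := det2_deriv_chord_pos hL hγ1 (by simpa using hper 0) hreg hor hKconv
    hKcomp.isClosed hKint hKbd ht.continuous fun s => by rw [hswap]; exact neg_ne_zero.2 (hc1 s)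
  have htd : Differentiable ℝ t := ht.differentiable (by norm_num)
  have hd : ∀ u, HasDerivAt γ (deriv γ u) u := fun u =>
    (hγ1.differentiable (by norm_num) u).hasDerivAt
  have hdd : Differentiable ℝ (deriv γ) :=
    ((contDiff_succ_iff_deriv (n := 1)).1 hγ).2.2.differentiable (by norm_num)
  have hb := fun s => hasDerivAt_buoyCurve hγ1 hδ0.ne' (htd s) hA
  set m : ℝ → ℝ := fun s => det2 (deriv γ s) (γ (t s) - γ s) / (6 * δ) with hm
  have hderiv : deriv (buoyCurve γ t δ) = fun s => m s • (γ (t s) - γ s) :=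
    funext fun s => (hb s).deriv
  intro s
  have hchord : HasDerivAt (fun s => γ (t s) - γ s) (deriv t s • deriv γ (t s) - deriv γ s) s :=
    ((hd (t s)).scomp s (htd s).hasDerivAt).sub (hd s)
  have hmd : DifferentiableAt ℝ m s := by
    have h1 := hasDerivAt_R2_iff.1 hchord
    have h2 := hasDerivAt_R2_iff.1 (hdd s).hasDerivAt
    exact (((h2.1.mul h1.2).sub (h2.2.mul h1.1)).div_const (6 * δ)).differentiableAt
  have h2 := hmd.hasDerivAt.smul hchord
  refine ⟨(hb s).differentiableAt, hderiv ▸ h2.differentiableAt, ?_⟩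
  have h2' : deriv (deriv (buoyCurve γ t δ)) s =
      m s • (deriv t s • deriv γ (t s) - deriv γ s) + deriv m s • (γ (t s) - γ s) := by
    rw [hderiv]
    exact h2.deriv
  have hms : 0 < m s := div_pos (hpos s) (by positivity)
  have hrel := chord_relation (fun u => (hasDerivAt_R2_iff.1 (hd u)).1)
    (fun u => (hasDerivAt_R2_iff.1 (hd u)).2) (by have := hγ1.continuous_deriv le_rfl; fun_prop)
    (by have := hγ1.continuous_deriv le_rfl; fun_prop) (htd s).hasDerivAt (D := 2 * δ)
    fun s => by
      have := hA s
      simp only [det2, PiLp.sub_apply] at this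
      linarith
  have hmδ : det2 (deriv γ s) (γ (t s) - γ s) = 6 * δ * m s := by rw [hm]; field_simp
  have hdet : det2 (m s • (γ (t s) - γ s)) (m s • (deriv t s • deriv γ (t s) - deriv γ s) +
      deriv m s • (γ (t s) - γ s)) = 12 * δ * m s ^ 3 := by
    simp only [det2, PiLp.sub_apply, PiLp.add_apply, PiLp.smul_apply, smul_eq_mul] at hmδ ⊢
    linear_combination m s ^ 2 * hrel + 2 * m s ^ 2 * hmδ
  rw [h2', hderiv]
  simp only []
  rw [hdet, norm_smul, Real.norm_of_nonneg hms.le, mul_pow, mul_comm (m s ^ 3),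
    mul_div_mul_right _ _ (pow_ne_zero 3 hms.ne')]
end
end

section
/- Under the illumination setup, the illumination curve r₃ is twice differentiable and its oriented curvature κ₃(s) = det(r₃'(s), r₃''(s)) / |r₃'(s)|³ is given by κ₃(s) = −det(γ'(s), γ'(t(s))) · ( det(c(s), γ'(t(s)))³·det(γ'(s), γ''(s)) − det(c(s), γ'(s))³·det(γ'(t(s)), γ''(t(s))) ) / ( |c(s)|³ · det(c(s), γ'(s)) · det(c(s), γ'(t(s))) · det(γ'(s), γ''(s)) · det(γ'(t(s)), γ''(t(s))) ) for every s. -/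
open Real MeasureTheory intervalIntegral

noncomputable section

/-- The intersection point of the tangent lines to `γ` at `γ(s)` and `γ(t(s))`. -/
def tangentPole (γ : ℝ → R2) (t : ℝ → ℝ) (s : ℝ) : R2 :=
  γ s + (det2 (γ (t s) - γ s) (deriv γ (t s)) / det2 (deriv γ s) (deriv γ (t s))) • deriv γ s

lemma det2_smul_left (m : ℝ) (u v : R2) : det2 (m • u) v = m * det2 u v := by
  simp [det2]; ring

lemma det2_smul_right (m : ℝ) (u v : R2) : det2 u (m • v) = m * det2 u v := by
  simp [det2]; ring

lemma det2_add_right (u v w : R2) : det2 u (v + w) = det2 u v + det2 u w := by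
  simp [det2]; ring

lemma det2_sub_left (u v w : R2) : det2 (u - v) w = det2 u w - det2 v w := by
  simp [det2]; ring

lemma det2_sub_right (u v w : R2) : det2 u (v - w) = det2 u v - det2 u w := by
  simp [det2]; ring

lemma det2_self (u : R2) : det2 u u = 0 := by
  simp [det2]; ring

lemma det2_swap (u v : R2) : det2 u v = -det2 v u := by
  simp [det2]; ring

/-- Cramer's rule in the plane. -/
lemma det2_smul_eq (u v w : R2) : det2 v w • u = det2 u w • v + det2 v u • w := by
  ext i
  fin_cases i <;> simp [det2] <;> ring

lemma hasDerivAt_coord {u : ℝ → R2} {u' : R2} {s : ℝ} (h : HasDerivAt u u' s) (i : Fin 2) :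
    HasDerivAt (fun x => u x i) (u' i) s :=
  (EuclideanSpace.proj (𝕜 := ℝ) i).hasFDerivAt.comp_hasDerivAt s h

lemma HasDerivAt.det2 {u v : ℝ → R2} {u' v' : R2} {s : ℝ}
    (hu : HasDerivAt u u' s) (hv : HasDerivAt v v' s) :
    HasDerivAt (fun x => det2 (u x) (v x)) (det2 u' (v s) + det2 (u s) v') s := by
  have h := ((hasDerivAt_coord hu 0).mul (hasDerivAt_coord hv 1)).sub
    ((hasDerivAt_coord hu 1).mul (hasDerivAt_coord hv 0))
  refine h.congr_deriv ?_
  simp only [_root_.det2]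
  ring

lemma Continuous.det2 {u v : ℝ → R2} (hu : Continuous u) (hv : Continuous v) :
    Continuous (fun x => det2 (u x) (v x)) := by
  unfold _root_.det2
  fun_prop

lemma clm_apply_R2 (f : R2 →L[ℝ] ℝ) (v : R2) :
    f v = f (EuclideanSpace.single 0 1) * v 0 + f (EuclideanSpace.single 1 1) * v 1 := by
  have hv : v = v 0 • EuclideanSpace.single 0 (1 : ℝ) + v 1 • EuclideanSpace.single 1 (1 : ℝ) := by
    ext i
    fin_cases i <;> simp
  conv_lhs => rw [hv]
  simp [mul_comm]

/-- A functional on the plane vanishing at `w ≠ 0` is a multiple of `det2 w`. -/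
lemma exists_eq_mul_det2 (f : R2 →L[ℝ] ℝ) {w : R2} (hw : w ≠ 0) (hf : f w = 0) :
    ∃ α : ℝ, ∀ v, f v = α * det2 w v := by
  have hn : w 0 ^ 2 + w 1 ^ 2 ≠ 0 := by
    intro h
    apply hw
    ext i
    fin_cases i
    · simpa using (by nlinarith [sq_nonneg (w 0), sq_nonneg (w 1)] : w 0 = 0)
    · simpa using (by nlinarith [sq_nonneg (w 0), sq_nonneg (w 1)] : w 1 = 0)
  rw [clm_apply_R2] at hf
  set p := f (EuclideanSpace.single 0 1)
  set q := f (EuclideanSpace.single 1 1)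
  refine ⟨(q * w 0 - p * w 1) / (w 0 ^ 2 + w 1 ^ 2), fun v => ?_⟩
  rw [clm_apply_R2, det2]
  field_simp
  linear_combination (v 0 * w 0 + v 1 * w 1) * hf

lemma Convex.exists_support_of_mem_frontier {K : Set R2} (hK : Convex ℝ K)
    (hint : (interior K).Nonempty) {x : R2} (hx : x ∈ frontier K) :
    ∃ f : R2 →L[ℝ] ℝ, f ≠ 0 ∧ ∀ y ∈ K, f y ≤ f x := by
  obtain ⟨f, hf⟩ := geometric_hahn_banach_open_point hK.interior isOpen_interior hx.2
  refine ⟨f, ?_, fun y hy => ?_⟩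
  · rintro rfl
    obtain ⟨z, hz⟩ := hint
    simpa using hf z hz
  · have hy' : y ∈ closure (interior K) := by
      rw [hK.closure_interior_eq_closure_of_nonempty_interior hint]
      exact subset_closure hy
    exact closure_minimal (fun z hz => (hf z hz).le : interior K ⊆ {z | f z ≤ f x})
      (isClosed_le f.continuous continuous_const) hy'

/-- A convex body bounded by a curve with positive curvature lies to the left of its tangents. -/
lemma det2_deriv_sub_nonneg {γ : ℝ → R2} {K : Set R2} (hK : Convex ℝ K) (hc : IsClosed K)
    (hint : (interior K).Nonempty) (hbd : frontier K = Set.range γ)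
    (h1 : ∀ s, HasDerivAt γ (deriv γ s) s)
    (h2 : ∀ s, HasDerivAt (deriv γ) (deriv (deriv γ) s) s)
    {s : ℝ} (hreg : deriv γ s ≠ 0) (hcurv : 0 < det2 (deriv γ s) (deriv (deriv γ) s)) (u : ℝ) :
    0 ≤ det2 (deriv γ s) (γ u - γ s) := by
  have hmem : ∀ x, γ x ∈ frontier K := fun x => hbd ▸ Set.mem_range_self x
  obtain ⟨f, hf0, hf⟩ := hK.exists_support_of_mem_frontier hint (hmem s)
  have hle : ∀ x, f (γ x) ≤ f (γ s) := fun x => hf _ (hc.frontier_subset (hmem x))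
  have hmax : IsLocalMax (fun x => f (γ x)) s := Filter.Eventually.of_forall hle
  have hz : f (deriv γ s) = 0 :=
    hmax.hasDerivAt_eq_zero (f.hasFDerivAt.comp_hasDerivAt s (h1 s))
  obtain ⟨α, hα⟩ := exists_eq_mul_det2 f hreg hz
  have hα0 : α ≠ 0 := by
    rintro rfl
    exact hf0 (by ext v; simp [hα])
  set φ : ℝ → ℝ := fun x => det2 (deriv γ s) (γ x - γ s) with hφ
  have hαφ : ∀ x, α * φ x ≤ 0 := by
    intro x
    have := hle x
    rw [hα, hα] at this
    rw [hφ]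
    simp only [det2_sub_right]
    linarith
  have d1 : ∀ x, HasDerivAt φ (det2 (deriv γ s) (deriv γ x)) x := fun x =>
    ((hasDerivAt_const x (deriv γ s)).det2 ((h1 x).sub_const (γ s))).congr_deriv
      (by simp [det2])
  have e1 : deriv φ = fun x => det2 (deriv γ s) (deriv γ x) := funext fun x => (d1 x).deriv
  have d2 : deriv (deriv φ) s = det2 (deriv γ s) (deriv (deriv γ) s) := by
    rw [e1]
    exact (((hasDerivAt_const s (deriv γ s)).det2 (h2 s)).congr_deriv (by simp [det2])).deriv
  rcases lt_or_gt_of_ne hα0 with h | h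
  · nlinarith [hαφ u]
  · exfalso
    have hmin : IsLocalMin φ s :=
      isLocalMin_of_deriv_deriv_pos (by rw [d2]; exact hcurv)
        (by rw [e1]; exact det2_self _) (d1 s).continuousAt
    have hφs : φ s = 0 := by simp [hφ, det2]
    have hzero : φ =ᶠ[nhds s] fun _ => 0 := by
      filter_upwards [hmin] with x hx
      have := hαφ x
      rw [hφs] at hx
      nlinarith
    have := hzero.deriv.deriv_eq
    rw [d2] at this
    simp at this
    exact hcurv.ne' this

lemma integral_det2_sub {γ : ℝ → R2} (hγ : Continuous γ) (hγ' : Continuous (deriv γ))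
    (h1 : ∀ s, HasDerivAt γ (deriv γ s) s) (r : R2) (x y : ℝ) :
    ∫ u in x..y, det2 (γ u - r) (deriv γ u) =
      ((∫ u in (0:ℝ)..y, det2 (γ u) (deriv γ u)) - ∫ u in (0:ℝ)..x, det2 (γ u) (deriv γ u)) -
        det2 r (γ y - γ x) := by
  have hi : ∀ a b : ℝ, IntervalIntegrable (fun u => det2 (γ u) (deriv γ u)) volume a b :=
    fun a b => (hγ.det2 hγ').intervalIntegrable a b
  have hj : IntervalIntegrable (fun u => det2 r (deriv γ u)) volume x y :=
    (continuous_const.det2 hγ').intervalIntegrable x y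
  have hr : ∫ u in x..y, det2 r (deriv γ u) = det2 r (γ y) - det2 r (γ x) :=
    integral_eq_sub_of_hasDerivAt (f := fun u => det2 r (γ u)) (fun u _ =>
      ((hasDerivAt_const u r).det2 (h1 u)).congr_deriv (by simp [det2])) hj
  simp_rw [det2_sub_left]
  rw [integral_sub (hi x y) hj, hr, integral_interval_sub_left (hi 0 y) (hi 0 x), det2_sub_right]

lemma tangentPole_sub_left (γ : ℝ → R2) (t : ℝ → ℝ) (s : ℝ) :
    det2 (tangentPole γ t s - γ s) (deriv γ s) = 0 := by
  simp [tangentPole, det2]; ring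

lemma tangentPole_sub_right (γ : ℝ → R2) (t : ℝ → ℝ) (s : ℝ)
    (hpar : det2 (deriv γ s) (deriv γ (t s)) ≠ 0) :
    det2 (tangentPole γ t s - γ (t s)) (deriv γ (t s)) = 0 := by
  have : tangentPole γ t s - γ (t s) = (det2 (γ (t s) - γ s) (deriv γ (t s)) /
      det2 (deriv γ s) (deriv γ (t s))) • deriv γ s - (γ (t s) - γ s) := by
    rw [tangentPole]; abel
  rw [this, det2_sub_left, det2_smul_left]
  field_simp
  ring

lemma tangentPole_sub_eq (γ : ℝ → R2) (t : ℝ → ℝ) (s : ℝ)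
    (hpar : det2 (deriv γ s) (deriv γ (t s)) ≠ 0) :
    tangentPole γ t s - γ (t s) = (det2 (γ (t s) - γ s) (deriv γ s) /
      det2 (deriv γ s) (deriv γ (t s))) • deriv γ (t s) := by
  have h := det2_smul_eq (γ (t s) - γ s) (deriv γ s) (deriv γ (t s))
  rw [det2_swap (deriv γ s) (γ (t s) - γ s)] at h
  have h' : γ (t s) - γ s = (det2 (γ (t s) - γ s) (deriv γ (t s)) /
      det2 (deriv γ s) (deriv γ (t s))) • deriv γ s - (det2 (γ (t s) - γ s) (deriv γ s) /
      det2 (deriv γ s) (deriv γ (t s))) • deriv γ (t s) := by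
    apply smul_right_injective R2 hpar
    simp only [smul_sub, smul_smul, mul_div_cancel₀ _ hpar]
    rw [← smul_sub, h, neg_smul, ← sub_eq_add_neg]
  have h2 : tangentPole γ t s - γ (t s) = (det2 (γ (t s) - γ s) (deriv γ (t s)) /
      det2 (deriv γ s) (deriv γ (t s))) • deriv γ s - (γ (t s) - γ s) := by
    rw [tangentPole]; abel
  rw [h2]
  nth_rewrite 2 [h']
  abel

/-- the oriented curvature of the illumination curve. -/
theorem stmt5
    (γ : ℝ → R2) (L : ℝ) (hL : 0 < L)
    (hγ : ContDiff ℝ 3 γ)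
    (hper : ∀ s, γ (s + L) = γ s)
    (hreg : ∀ s, deriv γ s ≠ 0)
    (hinj : Set.InjOn γ (Set.Ico 0 L))
    (hor : 0 < ∫ s in (0:ℝ)..L, det2 (γ s) (deriv γ s))
    (hcurv : ∀ s, 0 < det2 (deriv γ s) (deriv (deriv γ) s))
    (K : Set R2) (hKconv : Convex ℝ K) (hKcomp : IsCompact K)
    (hKint : (interior K).Nonempty) (hKbd : frontier K = Set.range γ)
    (δ' : ℝ) (hδ0 : 0 < δ')
    (t : ℝ → ℝ) (ht : ContDiff ℝ 1 t)
    (htrange : ∀ s, s < t s ∧ t s < s + L)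
    (hpar : ∀ s, det2 (deriv γ s) (deriv γ (t s)) ≠ 0)
    (hc1 : ∀ s, det2 (γ (t s) - γ s) (deriv γ s) ≠ 0)
    (hc2 : ∀ s, det2 (γ (t s) - γ s) (deriv γ (t s)) ≠ 0)
    (hA : ∀ s, -(1/2) * ∫ u in s..t s, det2 (γ u - tangentPole γ t s) (deriv γ u) = δ') :
    ∀ s : ℝ,
      DifferentiableAt ℝ (tangentPole γ t) s ∧
      DifferentiableAt ℝ (deriv (tangentPole γ t)) s ∧
      det2 (deriv (tangentPole γ t) s) (deriv (deriv (tangentPole γ t)) s) /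
          ‖deriv (tangentPole γ t) s‖ ^ 3 =
        -(det2 (deriv γ s) (deriv γ (t s))) *
            (det2 (γ (t s) - γ s) (deriv γ (t s)) ^ 3 * det2 (deriv γ s) (deriv (deriv γ) s) -
              det2 (γ (t s) - γ s) (deriv γ s) ^ 3 *
                det2 (deriv γ (t s)) (deriv (deriv γ) (t s))) /
          (‖γ (t s) - γ s‖ ^ 3 * det2 (γ (t s) - γ s) (deriv γ s) *
            det2 (γ (t s) - γ s) (deriv γ (t s)) * det2 (deriv γ s) (deriv (deriv γ) s) *
            det2 (deriv γ (t s)) (deriv (deriv γ) (t s))) := by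
  have hCγ' : ContDiff ℝ 2 (deriv γ) := (show ContDiff ℝ (2 + 1) γ from hγ).deriv'
  have hCγ'' : ContDiff ℝ 1 (deriv (deriv γ)) :=
    (show ContDiff ℝ (1 + 1) (deriv γ) from hCγ').deriv'
  have h1 : ∀ s, HasDerivAt γ (deriv γ s) s := fun s =>
    (hγ.differentiable (by norm_num) s).hasDerivAt
  have h2 : ∀ s, HasDerivAt (deriv γ) (deriv (deriv γ) s) s := fun s =>
    (hCγ'.differentiable (by norm_num) s).hasDerivAt
  have h3 : ∀ s, HasDerivAt (deriv (deriv γ)) (deriv (deriv (deriv γ)) s) s := fun s =>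
    (hCγ''.differentiable (by norm_num) s).hasDerivAt
  have hT : ∀ s, HasDerivAt t (deriv t s) s := fun s =>
    (ht.differentiable (by norm_num) s).hasDerivAt
  have hG : ∀ s, HasDerivAt (fun x => γ (t x)) (deriv t s • deriv γ (t s)) s := fun s =>
    (h1 (t s)).scomp s (hT s)
  have hG' : ∀ s, HasDerivAt (fun x => deriv γ (t x)) (deriv t s • deriv (deriv γ) (t s)) s :=
    fun s => (h2 (t s)).scomp s (hT s)
  have hc : ∀ s, HasDerivAt (fun x => γ (t x) - γ x)
      (deriv t s • deriv γ (t s) - deriv γ s) s := fun s => (hG s).sub (h1 s)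
  have hsupp : ∀ s u, 0 ≤ det2 (deriv γ s) (γ u - γ s) := fun s u =>
    det2_deriv_sub_nonneg hKconv hKcomp.isClosed hKint hKbd h1 h2 (hreg s) (hcurv s) u
  have he : ∀ s, det2 (γ (t s) - γ s) (deriv γ s) < 0 := fun s =>
    lt_of_le_of_ne (by rw [det2_swap]; linarith [hsupp s (t s)]) (hc1 s)
  have ha : ∀ s, 0 < det2 (γ (t s) - γ s) (deriv γ (t s)) := fun s => by
    refine lt_of_le_of_ne ?_ (hc2 s).symm
    have := hsupp (t s) s
    simp only [det2, PiLp.sub_apply] at this ⊢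
    linarith
  have hb : ∀ s, 0 < det2 (deriv γ s) (deriv γ (t s)) := fun s => by
    by_contra hcon
    have hb' := lt_of_le_of_ne (not_lt.1 hcon) (hpar s)
    have hI : 0 ≤ ∫ u in s..t s, det2 (γ u - γ s) (deriv γ u) :=
      integral_nonneg (htrange s).1.le fun u _ => by
        have := hsupp u s
        simp only [det2, PiLp.sub_apply] at this ⊢
        linarith
    have hA' := hA s
    rw [integral_det2_sub hγ.continuous hCγ'.continuous h1] at hA' hI
    have hd : det2 (tangentPole γ t s) (γ (t s) - γ s) = det2 (γ s) (γ (t s) - γ s) -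
        det2 (γ (t s) - γ s) (deriv γ (t s)) * det2 (γ (t s) - γ s) (deriv γ s) /
          det2 (deriv γ s) (deriv γ (t s)) := by
      simp only [tangentPole, det2, PiLp.sub_apply, PiLp.add_apply, PiLp.smul_apply, smul_eq_mul]
      ring
    have hpos : 0 < det2 (γ (t s) - γ s) (deriv γ (t s)) * det2 (γ (t s) - γ s) (deriv γ s) /
        det2 (deriv γ s) (deriv γ (t s)) :=
      div_pos_of_neg_of_neg (mul_neg_of_pos_of_neg (ha s) (he s)) hb'
    linarith
  have hr : ∀ s, HasDerivAt (tangentPole γ t) (deriv (tangentPole γ t) s) s := fun s =>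
    ((h1 s).add ((((hc s).det2 (hG' s)).div ((h2 s).det2 (hG' s)) (hpar s)).smul
      (h2 s))).differentiableAt.hasDerivAt
  have hF : ∀ x, HasDerivAt (fun y => ∫ u in (0:ℝ)..y, det2 (γ u) (deriv γ u))
      (det2 (γ x) (deriv γ x)) x := fun x =>
    (hγ.continuous.det2 hCγ'.continuous).integral_hasStrictDerivAt 0 x |>.hasDerivAt
  have hrc : ∀ s, det2 (γ (t s) - γ s) (deriv (tangentPole γ t) s) = 0 := fun s => by
    have hD := (((hF (t s)).comp s (hT s)).sub (hF s)).sub ((hr s).det2 (hc s))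
    have hconst : (fun x => ((∫ u in (0:ℝ)..t x, det2 (γ u) (deriv γ u)) -
        ∫ u in (0:ℝ)..x, det2 (γ u) (deriv γ u)) -
        det2 (tangentPole γ t x) (γ (t x) - γ x)) = fun _ => -2 * δ' := by
      funext x
      have := hA x
      rw [integral_det2_sub hγ.continuous hCγ'.continuous h1] at this
      linarith
    have h0 := hD.unique (hconst ▸ hasDerivAt_const s (-2 * δ'))
    have hl := tangentPole_sub_left γ t s
    have hrr := tangentPole_sub_right γ t s (hpar s)
    rw [det2_swap]
    simp only [det2_sub_left, det2_sub_right, det2_smul_right] at h0 hl hrr ⊢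
    linear_combination h0 + deriv t s * hrr - hl
  have hrl : ∀ s, det2 (deriv (tangentPole γ t) s) (deriv γ s) =
      -(det2 (γ (t s) - γ s) (deriv γ (t s)) / det2 (deriv γ s) (deriv γ (t s)) *
        det2 (deriv γ s) (deriv (deriv γ) s)) := fun s => by
    have hD := ((hr s).sub (h1 s)).det2 (h2 s)
    have h0 := hD.unique ((funext fun x => tangentPole_sub_left γ t x) ▸
      hasDerivAt_const s (0 : ℝ))
    have hs : tangentPole γ t s - γ s = (det2 (γ (t s) - γ s) (deriv γ (t s)) /
        det2 (deriv γ s) (deriv γ (t s))) • deriv γ s := by simp [tangentPole]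
    simp only [Pi.sub_apply, hs, det2_smul_left, det2_sub_left, det2_self] at h0 ⊢
    linarith
  have hrr : ∀ s, det2 (deriv (tangentPole γ t) s) (deriv γ (t s)) =
      -(deriv t s * (det2 (γ (t s) - γ s) (deriv γ s) / det2 (deriv γ s) (deriv γ (t s)) *
        det2 (deriv γ (t s)) (deriv (deriv γ) (t s)))) := fun s => by
    have hD := ((hr s).sub (hG s)).det2 (hG' s)
    have h0 := hD.unique ((funext fun x => tangentPole_sub_right γ t x (hpar x)) ▸
      hasDerivAt_const s (0 : ℝ))
    simp only [Pi.sub_apply, tangentPole_sub_eq γ t s (hpar s), det2_smul_left, det2_smul_right,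
      det2_sub_left, det2_self] at h0 ⊢
    linarith
  set m : ℝ → ℝ := fun s => -(det2 (γ (t s) - γ s) (deriv γ (t s)) *
    det2 (deriv γ s) (deriv (deriv γ) s)) /
      (det2 (deriv γ s) (deriv γ (t s)) * det2 (γ (t s) - γ s) (deriv γ s)) with hm
  have hderiv : deriv (tangentPole γ t) = fun s => m s • (γ (t s) - γ s) := by
    funext s
    have h := det2_smul_eq (deriv (tangentPole γ t) s) (γ (t s) - γ s) (deriv γ s)
    rw [hrc s, zero_smul, add_zero, hrl s] at h
    apply smul_right_injective R2 (hc1 s)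
    simp only [h, smul_smul]
    congr 1
    have := hpar s
    have := hc1 s
    rw [hm]
    field_simp
  intro s
  have hmd : HasDerivAt m (deriv m s) s :=
    ((((hc s).det2 (hG' s)).mul ((h2 s).det2 (h3 s))).neg.div
      (((h2 s).det2 (hG' s)).mul ((hc s).det2 (h2 s)))
        (mul_ne_zero (hpar s) (hc1 s))).differentiableAt.hasDerivAt
  have hr2' : HasDerivAt (deriv (tangentPole γ t))
      (m s • (deriv t s • deriv γ (t s) - deriv γ s) + deriv m s • (γ (t s) - γ s)) s := by
    rw [hderiv]; exact hmd.smul (hc s)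
  refine ⟨(hr s).differentiableAt, hr2'.differentiableAt, ?_⟩
  have hmpos : 0 < m s :=
    div_pos_of_neg_of_neg (neg_neg_of_pos (mul_pos (ha s) (hcurv s)))
      (mul_neg_of_pos_of_neg (hb s) (he s))
  have hcn : 0 < ‖γ (t s) - γ s‖ := norm_pos_iff.2 fun h => hc1 s (by simp [h, det2])
  have hk := hrr s
  rw [hr2'.deriv]
  rw [hderiv] at hk ⊢
  simp only [det2_smul_left, det2_smul_right, det2_add_right, det2_self, norm_smul,
    Real.norm_eq_abs, abs_of_pos hmpos] at hk ⊢
  rw [det2_sub_right, det2_smul_right]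
  have hmeq : m s * (det2 (deriv γ s) (deriv γ (t s)) * det2 (γ (t s) - γ s) (deriv γ s)) =
      -(det2 (γ (t s) - γ s) (deriv γ (t s)) * det2 (deriv γ s) (deriv (deriv γ) s)) :=
    div_mul_cancel₀ _ (mul_ne_zero (hpar s) (hc1 s))
  generalize m s = M at *
  have ha' := ha s
  have hb' := hb s
  have he' := (he s).ne
  have hk1 := hcurv s
  have hk2 := hcurv (t s)
  generalize det2 (γ (t s) - γ s) (deriv γ (t s)) = a at *
  generalize det2 (γ (t s) - γ s) (deriv γ s) = e at *
  generalize det2 (deriv γ s) (deriv γ (t s)) = b at *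
  generalize det2 (deriv γ s) (deriv (deriv γ) s) = k at *
  generalize det2 (deriv γ (t s)) (deriv (deriv γ) (t s)) = l at *
  generalize ‖γ (t s) - γ s‖ = n at *
  have hM : M = -(a * k) / (b * e) := by
    rw [eq_div_iff (mul_ne_zero hb'.ne' he')]; exact hmeq
  have ht' : deriv t s = a ^ 2 * k / (e ^ 2 * l) := by
    rw [hM] at hk
    field_simp at hk ⊢
    linarith
  rw [ht', hM]
  field_simp
  ring
end
end

section
/- Let K ⊂ ℝ² be a convex body whose boundary is parametrized by an L-periodic regular curve γ : ℝ → ℝ² of class C², injective on [0,L) and positively oriented. Suppose U ⊆ ℝ² is an open set of parameter pairs such that (i) for every (s,t) ∈ U one has γ(s) ≠ γ(t), det(γ(t) − γ(s), γ'(s)) ≠ 0, det(γ(t) − γ(s), γ'(t)) ≠ 0, and det(γ(t) − γ(s), γ'(s))³ · det(γ'(t), γ''(t)) + det(γ(t) − γ(s), γ'(t))³ · det(γ'(s), γ''(s)) = 0, and (ii) for every s ∈ ℝ there exists t with (s,t) ∈ U (the chords with parameters in U cover the boundary of K). Then the image of γ is an ellipse. -/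
open Real MeasureTheory intervalIntegral

noncomputable section

/-- Every real number has a real cube root. -/
lemma exists_cube_eq (k : ℝ) : ∃ r : ℝ, r ^ 3 = k := by
  have key : ∀ k : ℝ, 0 ≤ k → ∃ r : ℝ, r ^ 3 = k := fun k hk =>
    ⟨k ^ (((3 : ℕ) : ℝ)⁻¹), Real.rpow_inv_natCast_pow hk (by norm_num)⟩
  rcases le_total 0 k with hk | hk
  · exact key k hk
  · obtain ⟨r, hr⟩ := key (-k) (by linarith)
    exact ⟨-r, by linear_combination -hr⟩

lemma eventually_left_mem {U : Set (ℝ × ℝ)} (hU : IsOpen U) {s t : ℝ} (h : (s, t) ∈ U) :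
    ∀ᶠ s' in nhds s, (s', t) ∈ U :=
  (hU.preimage (f := fun s' : ℝ => (s', t)) (by fun_prop)).mem_nhds h

lemma eventually_right_mem {U : Set (ℝ × ℝ)} (hU : IsOpen U) {s t : ℝ} (h : (s, t) ∈ U) :
    ∀ᶠ t' in nhds t, (s, t') ∈ U :=
  (hU.preimage (f := fun t' : ℝ => (s, t')) (by fun_prop)).mem_nhds h

/-- If `F` vanishes on an open set, so does its first partial derivative. -/
lemma partial_left_eq_zero {U : Set (ℝ × ℝ)} (hU : IsOpen U) {F : ℝ → ℝ → ℝ}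
    (hF : ∀ s t, (s, t) ∈ U → F s t = 0) {s t D : ℝ} (h : (s, t) ∈ U)
    (hD : HasDerivAt (fun s' => F s' t) D s) : D = 0 := by
  have h0 : (fun s' => F s' t) =ᶠ[nhds s] fun _ => 0 :=
    (eventually_left_mem hU h).mono fun s' hs' => hF s' t hs'
  exact hD.unique ((hasDerivAt_const s (0 : ℝ)).congr_of_eventuallyEq h0)

/-- If `F` vanishes on an open set, so does its second partial derivative. -/
lemma partial_right_eq_zero {U : Set (ℝ × ℝ)} (hU : IsOpen U) {F : ℝ → ℝ → ℝ}
    (hF : ∀ s t, (s, t) ∈ U → F s t = 0) {s t D : ℝ} (h : (s, t) ∈ U)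
    (hD : HasDerivAt (fun t' => F s t') D t) : D = 0 := by
  have h0 : (fun t' => F s t') =ᶠ[nhds t] fun _ => 0 :=
    (eventually_right_mem hU h).mono fun t' ht' => hF s t' ht'
  exact hD.unique ((hasDerivAt_const t (0 : ℝ)).congr_of_eventuallyEq h0)

/-- The derivative of a periodic function is periodic. -/
lemma periodic_of_hasDerivAt {f f' : ℝ → ℝ} {L : ℝ} (hf : Function.Periodic f L)
    (h : ∀ s, HasDerivAt f (f' s) s) : Function.Periodic f' L := fun s => by
  have h1 := (h (s + L)).comp_add_const s L
  rw [show (fun x => f (x + L)) = f from funext hf] at h1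
  exact h1.unique (h s)

/-- A closed regular plane curve of class `C²` has a point of nonzero curvature. -/
lemma exists_curvature_ne_zero {x y x1 y1 x2 y2 : ℝ → ℝ} {L : ℝ} (hL : 0 < L)
    (hx : ∀ s, HasDerivAt x (x1 s) s) (hy : ∀ s, HasDerivAt y (y1 s) s)
    (hx1 : ∀ s, HasDerivAt x1 (x2 s) s) (hy1 : ∀ s, HasDerivAt y1 (y2 s) s)
    (px : Function.Periodic x L) (py : Function.Periodic y L)
    (hreg : ∀ s, x1 s ≠ 0 ∨ y1 s ≠ 0) : ∃ s, x1 s * y2 s - y1 s * x2 s ≠ 0 := by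
  by_contra! hk
  set h : ℝ → ℝ := fun s => x s ^ 2 + y s ^ 2 with hh
  have hd : ∀ s, HasDerivAt h (2 * (x s * x1 s + y s * y1 s)) s := fun s => by
    refine (((hx s).pow 2).add ((hy s).pow 2)).congr_deriv ?_
    push_cast; ring
  have hdd : ∀ s, HasDerivAt (fun s => 2 * (x s * x1 s + y s * y1 s))
      (2 * (x1 s * x1 s + x s * x2 s + (y1 s * y1 s + y s * y2 s))) s := fun s =>
    (((hx s).mul (hx1 s)).add ((hy s).mul (hy1 s))).const_mul 2
  have hcont : Continuous h := continuous_iff_continuousAt.2 fun s => (hd s).continuousAt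
  have hp : Function.Periodic h L := fun s => by simp only [hh, px s, py s]
  obtain ⟨s, -, hs⟩ := isCompact_Icc.exists_isMaxOn (Set.nonempty_Icc.2 hL.le) hcont.continuousOn
  have hmax : ∀ t, h t ≤ h s := fun t => by
    obtain ⟨u, hu, e⟩ := hp.exists_mem_Ico₀ hL t
    rw [e]; exact hs (Set.Ico_subset_Icc_self hu)
  have hlm : IsLocalMax h s := Filter.Eventually.of_forall hmax
  have h1 : 2 * (x s * x1 s + y s * y1 s) = 0 := hlm.hasDerivAt_eq_zero (hd s)
  have hderiv : deriv h = fun s => 2 * (x s * x1 s + y s * y1 s) := funext fun s => (hd s).deriv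
  have horth : x s * x2 s + y s * y2 s = 0 := by
    have e := hk s
    rcases hreg s with h0 | h0 <;> apply mul_left_cancel₀ h0
    · linear_combination y s * e + x2 s * h1 / 2
    · linear_combination -x s * e + y2 s * h1 / 2
  have hpos : 0 < 2 * (x1 s * x1 s + x s * x2 s + (y1 s * y1 s + y s * y2 s)) := by
    rcases hreg s with h0 | h0 <;> nlinarith [mul_self_pos.2 h0, mul_self_nonneg (x1 s),
      mul_self_nonneg (y1 s)]
  have hlmin : IsLocalMin h s := isLocalMin_of_deriv_deriv_pos
    (by rw [hderiv, (hdd s).deriv]; exact hpos) (by rw [hderiv]; exact h1) hcont.continuousAt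
  have hc : h =ᶠ[nhds s] fun _ => h s := by
    filter_upwards [hlmin] with t ht using le_antisymm (hmax t) ht
  have h2 : deriv (deriv h) s = 0 := by
    rw [hc.deriv.deriv_eq]; simp
  rw [hderiv, (hdd s).deriv] at h2
  exact hpos.ne' h2

/-- A field `a` along a `C²` curve satisfying the chord relation
`det(γ(t) - γ(s), a(s) + a(t)) = 0` is itself of class `C²`. -/
lemma contDiff_of_chord_relation {x y x1 y1 a1 a2 : ℝ → ℝ} {U : Set (ℝ × ℝ)} (hU : IsOpen U)
    (hcx : ContDiff ℝ 2 x) (hcy : ContDiff ℝ 2 y)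
    (hx : ∀ s, HasDerivAt x (x1 s) s) (hy : ∀ s, HasDerivAt y (y1 s) s)
    (hF : ∀ s t, (s, t) ∈ U →
      (x t - x s) * (a2 s + a2 t) - (y t - y s) * (a1 s + a1 t) = 0)
    (hB : ∀ s t, (s, t) ∈ U → (x t - x s) * y1 t - (y t - y s) * x1 t ≠ 0)
    (hcover : ∀ s, ∃ t, (s, t) ∈ U) : ContDiff ℝ 2 a1 ∧ ContDiff ℝ 2 a2 := by
  have key : ∀ s, ContDiffAt ℝ 2 a1 s ∧ ContDiffAt ℝ 2 a2 s := by
    intro s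
    obtain ⟨t, ht⟩ := hcover s
    have hd : HasDerivAt (fun u => (x t - x s) * (y u - y s) - (y t - y s) * (x u - x s))
        ((x t - x s) * y1 t - (y t - y s) * x1 t) t :=
      (((hy t).sub_const (y s)).const_mul _).sub (((hx t).sub_const (x s)).const_mul _)
    obtain ⟨u, hu, hus⟩ := ((hd.eventually_ne (c := 0) (hB s t ht)).and
      ((eventually_right_mem hU ht).filter_mono nhdsWithin_le_nhds)).exists
    set Δ : ℝ → ℝ := fun s => (x t - x s) * (y u - y s) - (y t - y s) * (x u - x s) with hΔ
    have hΔc : ContDiff ℝ 2 Δ := by rw [hΔ]; fun_prop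
    have hΔ0 : ∀ᶠ s' in nhds s, Δ s' ≠ 0 := hΔc.continuous.continuousAt.eventually_ne hu
    set g : ℝ → ℝ → ℝ := fun v s => -((x v - x s) * a2 v - (y v - y s) * a1 v) with hg
    have hgc : ∀ v, ContDiff ℝ 2 (g v) := fun v => by rw [hg]; fun_prop
    have hE := (hΔ0.and ((eventually_left_mem hU ht).and (eventually_left_mem hU hus)))
    constructor
    · have hq : ContDiffAt ℝ 2 (fun s' => (g t s' * (x u - x s') - g u s' * (x t - x s')) / Δ s') s :=
        ContDiffAt.div (by have := hgc t; have := hgc u; fun_prop) hΔc.contDiffAt hu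
      refine hq.congr_of_eventuallyEq ?_
      filter_upwards [hE] with s' ⟨h0, h1, h2⟩
      rw [eq_div_iff h0]
      simp only [hΔ, hg]
      linear_combination (x u - x s') * hF s' t h1 - (x t - x s') * hF s' u h2
    · have hq : ContDiffAt ℝ 2 (fun s' => (g t s' * (y u - y s') - g u s' * (y t - y s')) / Δ s') s :=
        ContDiffAt.div (by have := hgc t; have := hgc u; fun_prop) hΔc.contDiffAt hu
      refine hq.congr_of_eventuallyEq ?_
      filter_upwards [hE] with s' ⟨h0, h1, h2⟩
      rw [eq_div_iff h0]
      simp only [hΔ, hg]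
      linear_combination (y u - y s') * hF s' t h1 - (y t - y s') * hF s' u h2
  exact ⟨contDiff_iff_contDiffAt.2 fun s => (key s).1, contDiff_iff_contDiffAt.2 fun s => (key s).2⟩

/-- The chord relation forces the affine curvature `det(b, e)` to be constant. Here `a`, `b`, `e`
are the first three derivatives of the curve with respect to affine arclength, and `r` is the speed
of affine arclength. -/
lemma affine_curvature_const {x y a1 a2 b1 b2 e1 e2 r : ℝ → ℝ} {U : Set (ℝ × ℝ)} (hU : IsOpen U)
    (hr : ∀ s, r s ≠ 0)
    (hx : ∀ s, HasDerivAt x (r s * a1 s) s) (hy : ∀ s, HasDerivAt y (r s * a2 s) s)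
    (ha1 : ∀ s, HasDerivAt a1 (r s * b1 s) s) (ha2 : ∀ s, HasDerivAt a2 (r s * b2 s) s)
    (hb1 : ∀ s, HasDerivAt b1 (r s * e1 s) s) (hb2 : ∀ s, HasDerivAt b2 (r s * e2 s) s)
    (hab : ∀ s, a1 s * b2 s - a2 s * b1 s = 1)
    (hF : ∀ s t, (s, t) ∈ U →
      (x t - x s) * (a2 s + a2 t) - (y t - y s) * (a1 s + a1 t) = 0)
    (hA : ∀ s t, (s, t) ∈ U → (x t - x s) * a2 s - (y t - y s) * a1 s ≠ 0)
    (hcover : ∀ s, ∃ t, (s, t) ∈ U) :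
    ∃ μ : ℝ, ∀ s, e1 s = -μ * a1 s ∧ e2 s = -μ * a2 s := by
  have hae : ∀ s, a1 s * e2 s - a2 s * e1 s = 0 := fun s => by
    have hd := ((ha1 s).mul (hb2 s)).sub ((ha2 s).mul (hb1 s))
    have h0 := hd.unique ((hasDerivAt_const s (1 : ℝ)).congr_of_eventuallyEq
      (Filter.Eventually.of_forall hab))
    apply mul_left_cancel₀ (hr s)
    linear_combination h0
  set μ : ℝ → ℝ := fun s => b1 s * e2 s - b2 s * e1 s with hμ
  have he1 : ∀ s, e1 s = -μ s * a1 s := fun s => by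
    simp only [hμ]; linear_combination (-e1 s) * hab s + b1 s * hae s
  have he2 : ∀ s, e2 s = -μ s * a2 s := fun s => by
    simp only [hμ]; linear_combination (-e2 s) * hab s + b2 s * hae s
  have E1 : ∀ s t, (s, t) ∈ U →
      (x t - x s) * b2 s - (y t - y s) * b1 s - (a1 s * a2 t - a2 s * a1 t) = 0 := by
    intro s t h
    have := partial_left_eq_zero hU hF h
      ((((hx s).const_sub (x t)).mul ((ha2 s).add_const (a2 t))).sub
        (((hy s).const_sub (y t)).mul ((ha1 s).add_const (a1 t))))
    apply mul_left_cancel₀ (hr s)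
    linear_combination this
  have E2 : ∀ s t, (s, t) ∈ U →
      (x t - x s) * b2 t - (y t - y s) * b1 t - (a1 s * a2 t - a2 s * a1 t) = 0 := by
    intro s t h
    have := partial_right_eq_zero hU hF h
      ((((hx t).sub_const (x s)).mul ((ha2 t).const_add (a2 s))).sub
        (((hy t).sub_const (y s)).mul ((ha1 t).const_add (a1 s))))
    apply mul_left_cancel₀ (hr t)
    linear_combination this
  have E3 : ∀ s t, (s, t) ∈ U →
      (a1 t * b2 s - a2 t * b1 s) - (a1 s * b2 t - a2 s * b1 t) = 0 := by
    intro s t h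
    have := partial_right_eq_zero hU E1 h
      (((((hx t).sub_const (x s)).mul_const (b2 s)).sub
        (((hy t).sub_const (y s)).mul_const (b1 s))).sub
        (((ha2 t).const_mul (a1 s)).sub ((ha1 t).const_mul (a2 s))))
    apply mul_left_cancel₀ (hr t)
    linear_combination this
  have E4 : ∀ s t, (s, t) ∈ U →
      -(a1 s * b2 s - a2 s * b1 s) + ((x t - x s) * e2 s - (y t - y s) * e1 s)
        - (b1 s * a2 t - b2 s * a1 t) = 0 := by
    intro s t h
    have := partial_left_eq_zero hU E1 h
      (((((hx s).const_sub (x t)).mul (hb2 s)).sub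
        (((hy s).const_sub (y t)).mul (hb1 s))).sub
        (((ha1 s).mul_const (a2 t)).sub ((ha2 s).mul_const (a1 t))))
    apply mul_left_cancel₀ (hr s)
    linear_combination this
  have E5 : ∀ s t, (s, t) ∈ U →
      (a1 t * b2 t - a2 t * b1 t) + ((x t - x s) * e2 t - (y t - y s) * e1 t)
        - (a1 s * b2 t - a2 s * b1 t) = 0 := by
    intro s t h
    have := partial_right_eq_zero hU E2 h
      (((((hx t).sub_const (x s)).mul (hb2 t)).sub
        (((hy t).sub_const (y s)).mul (hb1 t))).sub
        (((ha2 t).const_mul (a1 s)).sub ((ha1 t).const_mul (a2 s))))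
    apply mul_left_cancel₀ (hr t)
    linear_combination this
  have hμU : ∀ s t, (s, t) ∈ U → μ s = μ t := by
    intro s t h
    have h4 := E4 s t h
    have h5 := E5 s t h
    rw [he1, he2, hab] at h4 h5
    apply mul_left_cancel₀ (hA s t h)
    linear_combination (-h4) - h5 + E3 s t h - μ t * hF s t h
  have hloc : IsLocallyConstant μ := (IsLocallyConstant.iff_eventually_eq μ).2 fun s => by
    obtain ⟨t, ht⟩ := hcover s
    filter_upwards [eventually_left_mem hU ht] with s' hs'
    rw [hμU s' t hs', hμU s t ht]
  refine ⟨μ 0, fun s => ?_⟩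
  rw [← hloc.apply_eq_of_preconnectedSpace s 0]
  exact ⟨he1 s, he2 s⟩

/-- Constant affine curvature of a closed curve is positive. -/
lemma affine_curvature_pos {a1 a2 b1 b2 r : ℝ → ℝ} {L μ : ℝ} (hL : 0 < L)
    (hr : ∀ s, r s ≠ 0)
    (ha1 : ∀ s, HasDerivAt a1 (r s * b1 s) s) (ha2 : ∀ s, HasDerivAt a2 (r s * b2 s) s)
    (hb1 : ∀ s, HasDerivAt b1 (r s * (-μ * a1 s)) s)
    (hb2 : ∀ s, HasDerivAt b2 (r s * (-μ * a2 s)) s)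
    (hab : ∀ s, a1 s * b2 s - a2 s * b1 s = 1)
    (pa1 : Function.Periodic a1 L) (pa2 : Function.Periodic a2 L)
    (pb1 : Function.Periodic b1 L) (pb2 : Function.Periodic b2 L) : 0 < μ := by
  by_contra! hμ
  have hd : ∀ s, HasDerivAt (fun s => a1 s * b1 s + a2 s * b2 s)
      (r s * (b1 s ^ 2 + b2 s ^ 2 - μ * (a1 s ^ 2 + a2 s ^ 2))) s := fun s => by
    refine (((ha1 s).mul (hb1 s)).add ((ha2 s).mul (hb2 s))).congr_deriv ?_
    ring
  obtain ⟨c, -, hc⟩ := exists_hasDerivAt_eq_zero hL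
    (fun s _ => (hd s).continuousAt.continuousWithinAt)
    (by simp only [pa1.eq, pa2.eq, pb1.eq, pb2.eq]) (fun s _ => hd s)
  have h0 := (mul_eq_zero.1 hc).resolve_left (hr c)
  have h1 : 0 ≤ -μ * (a1 c ^ 2 + a2 c ^ 2) := mul_nonneg (by linarith) (by positivity)
  have hb1z : b1 c = 0 := by nlinarith [sq_nonneg (b1 c), sq_nonneg (b2 c)]
  have hb2z : b2 c = 0 := by nlinarith [sq_nonneg (b1 c), sq_nonneg (b2 c)]
  have := hab c
  rw [hb1z, hb2z] at this
  norm_num at this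

/-- Solutions of the harmonic oscillator in the time variable `σ`. -/
lemma harmonic_solution {X a σ r : ℝ → ℝ} {ω : ℝ} (hω : 0 < ω) (h0 : σ 0 = 0)
    (hσ : ∀ s, HasDerivAt σ (r s) s) (hX : ∀ s, HasDerivAt X (r s * a s) s)
    (ha : ∀ s, HasDerivAt a (r s * (-ω ^ 2 * X s)) s) (s : ℝ) :
    X s = Real.cos (ω * σ s) * X 0 + Real.sin (ω * σ s) * (a 0 / ω) := by
  have hcos : ∀ s, HasDerivAt (fun s => Real.cos (ω * σ s)) _ s :=
    fun s => ((hσ s).const_mul ω).cos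
  have hsin : ∀ s, HasDerivAt (fun s => Real.sin (ω * σ s)) _ s :=
    fun s => ((hσ s).const_mul ω).sin
  have hP : ∀ s, HasDerivAt
      (fun s => Real.cos (ω * σ s) * X s - Real.sin (ω * σ s) * (a s / ω)) 0 s := fun s => by
    refine (((hcos s).mul (hX s)).sub ((hsin s).mul ((ha s).div_const ω))).congr_deriv ?_
    field_simp
    ring
  have hQ : ∀ s, HasDerivAt
      (fun s => Real.sin (ω * σ s) * X s + Real.cos (ω * σ s) * (a s / ω)) 0 s := fun s => by
    refine (((hsin s).mul (hX s)).add ((hcos s).mul ((ha s).div_const ω))).congr_deriv ?_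
    field_simp
    ring
  have eP := is_const_of_deriv_eq_zero (fun s => (hP s).differentiableAt)
    (fun s => (hP s).deriv) s 0
  have eQ := is_const_of_deriv_eq_zero (fun s => (hQ s).differentiableAt)
    (fun s => (hQ s).deriv) s 0
  simp only [h0, mul_zero, Real.cos_zero, Real.sin_zero, one_mul, zero_mul, sub_zero,
    zero_add] at eP eQ
  linear_combination Real.cos (ω * σ s) * eP + Real.sin (ω * σ s) * eQ
    - X s * Real.sin_sq_add_cos_sq (ω * σ s)

/-- The primitive of a nonvanishing continuous periodic function is onto. -/
lemma surjective_integral_of_periodic {r : ℝ → ℝ} {L : ℝ} (hL : 0 < L) (hc : Continuous r)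
    (hr : ∀ s, r s ≠ 0) (hp : Function.Periodic r L) :
    Function.Surjective fun s => ∫ u in (0 : ℝ)..s, r u := by
  have hd : ∀ s, HasDerivAt (fun s => ∫ u in (0 : ℝ)..s, r u) (r s) s :=
    fun s => (hc.integral_hasStrictDerivAt 0 s).hasDerivAt
  have hcont : Continuous fun s => ∫ u in (0 : ℝ)..s, r u :=
    continuous_iff_continuousAt.2 fun s => (hd s).continuousAt
  set w := ∫ u in (0 : ℝ)..L, r u with hw
  have hw0 : w ≠ 0 := fun h => by
    obtain ⟨c, -, h'⟩ := exists_hasDerivAt_eq_zero hL hcont.continuousOn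
      (by simpa using h.symm) (fun s _ => hd s)
    exact hr c h'
  have hn : ∀ n : ℤ, ∫ u in (0 : ℝ)..(n * L), r u = n * w := fun n => by
    have := hp.intervalIntegral_add_zsmul_eq n 0 fun _ _ => hc.intervalIntegrable _ _
    simpa using this
  intro z
  have e : z = z / w * w := by field_simp
  refine mem_range_of_exists_le_of_exists_ge hcont ?_ ?_ <;>
    rcases lt_or_gt_of_ne hw0 with h | h
  · refine ⟨⌈z / w⌉ * L, ?_⟩
    simp only [hn]; nlinarith [Int.le_ceil (z / w)]
  · refine ⟨⌊z / w⌋ * L, ?_⟩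
    simp only [hn]; nlinarith [Int.floor_le (z / w)]
  · refine ⟨⌊z / w⌋ * L, ?_⟩
    simp only [hn]; nlinarith [Int.floor_le (z / w)]
  · refine ⟨⌈z / w⌉ * L, ?_⟩
    simp only [hn]; nlinarith [Int.le_ceil (z / w)]

/-- The linear automorphism of the plane with columns `(p, q)` and `(u, v)`. -/
def planeEquiv (p q u v : ℝ) (h : p * v - q * u ≠ 0) : R2 ≃ₗ[ℝ] R2 where
  toFun z := !₂[p * z 0 + u * z 1, q * z 0 + v * z 1]
  map_add' z w := by ext i; fin_cases i <;> simp <;> ring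
  map_smul' c z := by ext i; fin_cases i <;> simp <;> ring
  invFun z := !₂[(v * z 0 - u * z 1) / (p * v - q * u), (p * z 1 - q * z 0) / (p * v - q * u)]
  left_inv z := by
    ext i
    fin_cases i <;> simp
    · linear_combination z 0 * mul_inv_cancel₀ h
    · linear_combination z 1 * mul_inv_cancel₀ h
  right_inv z := by
    ext i
    fin_cases i <;> simp
    · linear_combination z 0 * mul_inv_cancel₀ h
    · linear_combination z 1 * mul_inv_cancel₀ h

lemma mem_unit_sphere_iff (z : R2) :
    z ∈ Metric.sphere (0 : R2) 1 ↔ ∃ θ : ℝ, z = !₂[Real.cos θ, Real.sin θ] := by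
  rw [mem_sphere_zero_iff_norm, EuclideanSpace.norm_eq, Real.sqrt_eq_one]
  simp only [Fin.sum_univ_two, Real.norm_eq_abs, sq_abs]
  constructor
  · intro h
    have hn : ‖(⟨z 0, z 1⟩ : ℂ)‖ = 1 := by
      rw [Complex.norm_def, Real.sqrt_eq_one, Complex.normSq_mk]; linarith
    obtain ⟨θ, hθ⟩ := (Complex.norm_eq_one_iff _).1 hn
    refine ⟨θ, ?_⟩
    have h0 := congrArg Complex.re hθ
    have h1 := congrArg Complex.im hθ
    rw [Complex.exp_ofReal_mul_I_re] at h0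
    rw [Complex.exp_ofReal_mul_I_im] at h1
    ext i; fin_cases i
    · simpa using h0.symm
    · simpa using h1.symm
  · rintro ⟨θ, rfl⟩
    simp

/-- A closed curve of constant affine curvature traces an ellipse. -/
lemma range_eq_ellipse {γ : ℝ → R2} {a1 a2 b1 b2 r : ℝ → ℝ} {L μ : ℝ} (hL : 0 < L)
    (hr : ∀ s, r s ≠ 0) (hrc : Continuous r) (pr : Function.Periodic r L) (hμ : 0 < μ)
    (hx : ∀ s, HasDerivAt (fun s => γ s 0) (r s * a1 s) s)
    (hy : ∀ s, HasDerivAt (fun s => γ s 1) (r s * a2 s) s)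
    (ha1 : ∀ s, HasDerivAt a1 (r s * b1 s) s) (ha2 : ∀ s, HasDerivAt a2 (r s * b2 s) s)
    (hb1 : ∀ s, HasDerivAt b1 (r s * (-μ * a1 s)) s)
    (hb2 : ∀ s, HasDerivAt b2 (r s * (-μ * a2 s)) s)
    (hab : ∀ s, a1 s * b2 s - a2 s * b1 s = 1) :
    ∃ (T : R2 ≃ₗ[ℝ] R2) (b : R2),
      Set.range γ = (fun x => T x + b) '' Metric.sphere (0 : R2) 1 := by
  set ω := Real.sqrt μ
  have hω : 0 < ω := Real.sqrt_pos.2 hμ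
  have hω2 : ω ^ 2 = μ := Real.sq_sqrt hμ.le
  set σ : ℝ → ℝ := fun s => ∫ u in (0 : ℝ)..s, r u with hσd
  have hσ : ∀ s, HasDerivAt σ (r s) s :=
    fun s => (hrc.integral_hasStrictDerivAt 0 s).hasDerivAt
  have hσ0 : σ 0 = 0 := by simp [hσd]
  have hcen : ∀ {f a b : ℝ → ℝ}, (∀ s, HasDerivAt f (r s * a s) s) →
      (∀ s, HasDerivAt a (r s * b s) s) → (∀ s, HasDerivAt b (r s * (-μ * a s)) s) →
      ∀ s, f s = Real.cos (ω * σ s) * (-b 0 / μ) + Real.sin (ω * σ s) * (a 0 / ω)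
        + (f 0 + b 0 / μ) := by
    intro f a b hf ha hb s
    have hz : ∀ s, HasDerivAt (fun s => f s + b s / μ) 0 s := fun s => by
      refine ((hf s).add ((hb s).div_const μ)).congr_deriv ?_
      field_simp; ring
    have hconst := is_const_of_deriv_eq_zero (fun s => (hz s).differentiableAt)
      (fun s => (hz s).deriv) s 0
    have hX : ∀ s, HasDerivAt (fun s => -b s / μ) (r s * a s) s := fun s => by
      refine ((hb s).neg.div_const μ).congr_deriv ?_
      field_simp
    have ha' : ∀ s, HasDerivAt a (r s * (-ω ^ 2 * (-b s / μ))) s := fun s => by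
      refine (ha s).congr_deriv ?_
      rw [hω2]; field_simp
    have := harmonic_solution hω hσ0 hσ hX ha' s
    linear_combination this + hconst
  have hdet : (-b1 0 / μ) * (a2 0 / ω) - (-b2 0 / μ) * (a1 0 / ω) ≠ 0 := by
    have : (-b1 0 / μ) * (a2 0 / ω) - (-b2 0 / μ) * (a1 0 / ω) = 1 / (μ * ω) := by
      field_simp; linear_combination hab 0
    rw [this]; positivity
  refine ⟨planeEquiv _ _ _ _ hdet, !₂[γ 0 0 + b1 0 / μ, γ 0 1 + b2 0 / μ], ?_⟩
  have hγ : ∀ s, γ s = planeEquiv _ _ _ _ hdet !₂[Real.cos (ω * σ s), Real.sin (ω * σ s)]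
      + !₂[γ 0 0 + b1 0 / μ, γ 0 1 + b2 0 / μ] := fun s => by
    ext i; fin_cases i
    · have := hcen hx ha1 hb1 s
      simp [planeEquiv]
      linear_combination this
    · have := hcen hy ha2 hb2 s
      simp [planeEquiv]
      linear_combination this
  ext z
  constructor
  · rintro ⟨s, rfl⟩
    exact ⟨_, (mem_unit_sphere_iff _).2 ⟨_, rfl⟩, (hγ s).symm⟩
  · rintro ⟨w, hw, rfl⟩
    obtain ⟨θ, rfl⟩ := (mem_unit_sphere_iff _).1 hw
    obtain ⟨s, hs⟩ := surjective_integral_of_periodic hL hrc hr pr (θ / ω)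
    refine ⟨s, ?_⟩
    have hs' : ω * σ s = θ := by
      rw [show σ s = θ / ω from hs]; field_simp
    rw [hγ s, hs']

/-- if the equal-curvature condition holds on an open set of chords covering
the boundary, then `K` is an ellipse. -/
theorem stmt12
    (γ : ℝ → R2) (L : ℝ) (hL : 0 < L)
    (hγ : ContDiff ℝ 2 γ)
    (hper : ∀ s, γ (s + L) = γ s)
    (hreg : ∀ s, deriv γ s ≠ 0)
    (hinj : Set.InjOn γ (Set.Ico 0 L))
    (hor : 0 < ∫ s in (0:ℝ)..L, det2 (γ s) (deriv γ s))
    (K : Set R2) (hKconv : Convex ℝ K) (hKcomp : IsCompact K)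
    (hKint : (interior K).Nonempty) (hKbd : frontier K = Set.range γ)
    (U : Set (ℝ × ℝ)) (hUopen : IsOpen U)
    (hU : ∀ p ∈ U,
      γ p.1 ≠ γ p.2 ∧
      det2 (γ p.2 - γ p.1) (deriv γ p.1) ≠ 0 ∧
      det2 (γ p.2 - γ p.1) (deriv γ p.2) ≠ 0 ∧
      det2 (γ p.2 - γ p.1) (deriv γ p.1) ^ 3 * det2 (deriv γ p.2) (deriv (deriv γ) p.2) +
        det2 (γ p.2 - γ p.1) (deriv γ p.2) ^ 3 * det2 (deriv γ p.1) (deriv (deriv γ) p.1) = 0)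
    (hcover : ∀ s : ℝ, ∃ t : ℝ, (s, t) ∈ U) :
    ∃ (T : R2 ≃ₗ[ℝ] R2) (b : R2),
      Set.range γ = (fun x => T x + b) '' Metric.sphere (0:R2) 1 := by
  have hγ1 : ContDiff ℝ 1 (deriv γ) := (contDiff_succ_iff_deriv.1 hγ).2.2
  have hcoord : ∀ {f : ℝ → R2}, ContDiff ℝ 1 f → ∀ i s,
      HasDerivAt (fun s => f s i) (deriv f s i) s := fun hf i s =>
    (EuclideanSpace.proj (𝕜 := ℝ) i).hasFDerivAt.comp_hasDerivAt s
      (hf.differentiable one_ne_zero s).hasDerivAt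
  have hx := hcoord (hγ.of_le one_le_two) 0
  have hy := hcoord (hγ.of_le one_le_two) 1
  have hx1 := hcoord hγ1 0
  have hy1 := hcoord hγ1 1
  have px : Function.Periodic (fun s => γ s 0) L := fun s => by simp only [hper]
  have py : Function.Periodic (fun s => γ s 1) L := fun s => by simp only [hper]
  have px1 := periodic_of_hasDerivAt px hx
  have py1 := periodic_of_hasDerivAt py hy
  have px2 := periodic_of_hasDerivAt px1 hx1
  have py2 := periodic_of_hasDerivAt py1 hy1
  have cx1 := contDiff_euclidean.1 hγ1 0
  have cy1 := contDiff_euclidean.1 hγ1 1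
  have hreg' : ∀ s, deriv γ s 0 ≠ 0 ∨ deriv γ s 1 ≠ 0 := fun s => by
    by_contra! h
    exact hreg s (by ext i; fin_cases i; exacts [h.1, h.2])
  have hU' : ∀ s t, (s, t) ∈ U →
      (γ t 0 - γ s 0) * deriv γ s 1 - (γ t 1 - γ s 1) * deriv γ s 0 ≠ 0 ∧
      (γ t 0 - γ s 0) * deriv γ t 1 - (γ t 1 - γ s 1) * deriv γ t 0 ≠ 0 ∧
      ((γ t 0 - γ s 0) * deriv γ s 1 - (γ t 1 - γ s 1) * deriv γ s 0) ^ 3 *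
        (deriv γ t 0 * deriv (deriv γ) t 1 - deriv γ t 1 * deriv (deriv γ) t 0) +
      ((γ t 0 - γ s 0) * deriv γ t 1 - (γ t 1 - γ s 1) * deriv γ t 0) ^ 3 *
        (deriv γ s 0 * deriv (deriv γ) s 1 - deriv γ s 1 * deriv (deriv γ) s 0) = 0 :=
    fun s t h => (hU (s, t) h).2
  set x1 : ℝ → ℝ := fun s => deriv γ s 0
  set y1 : ℝ → ℝ := fun s => deriv γ s 1
  set x2 : ℝ → ℝ := fun s => deriv (deriv γ) s 0
  set y2 : ℝ → ℝ := fun s => deriv (deriv γ) s 1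
  set k : ℝ → ℝ := fun s => x1 s * y2 s - y1 s * x2 s with hk
  have hksymm : ∀ s t, (s, t) ∈ U → (k s = 0 ↔ k t = 0) := fun s t h => by
    obtain ⟨hA, hB, hE⟩ := hU' s t h
    change _ ^ 3 * k t + _ ^ 3 * k s = 0 at hE
    constructor <;> intro h0 <;> rw [h0, mul_zero] at hE
    · exact (mul_eq_zero.1 ((add_zero _).symm.trans hE)).resolve_left (pow_ne_zero 3 hA)
    · exact (mul_eq_zero.1 ((zero_add _).symm.trans hE)).resolve_left (pow_ne_zero 3 hB)
  have hk0 : ∀ s, k s ≠ 0 := by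
    have hloc : IsLocallyConstant fun s => (k s = 0) :=
      (IsLocallyConstant.iff_eventually_eq _).2 fun s => by
        obtain ⟨t, ht⟩ := hcover s
        filter_upwards [eventually_left_mem hUopen ht] with s' hs'
        exact propext ((hksymm s' t hs').trans (hksymm s t ht).symm)
    obtain ⟨s₀, hs₀⟩ := exists_curvature_ne_zero hL hx hy hx1 hy1 px py hreg'
    intro s hs
    exact hs₀ ((hloc.apply_eq_of_preconnectedSpace s s₀).mp hs)
  obtain ⟨c, hc⟩ : ∃ c : ℝ → ℝ, ∀ z, c z ^ 3 = z := ⟨_, fun z => (exists_cube_eq z).choose_spec⟩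
  set r : ℝ → ℝ := fun s => c (k s) with hr
  have hr3 : ∀ s, r s ^ 3 = k s := fun s => hc _
  have hr0 : ∀ s, r s ≠ 0 := fun s h => hk0 s (by rw [← hr3, h]; norm_num)
  have pr : Function.Periodic r L := fun s => by
    simp only [hr, hk, px1 s, py1 s, px2 s, py2 s]
  set a1 : ℝ → ℝ := fun s => x1 s / r s with ha1d
  set a2 : ℝ → ℝ := fun s => y1 s / r s with ha2d
  have ex : ∀ s, x1 s = r s * a1 s := fun s => (mul_div_cancel₀ _ (hr0 s)).symm
  have ey : ∀ s, y1 s = r s * a2 s := fun s => (mul_div_cancel₀ _ (hr0 s)).symm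
  have hF : ∀ s t, (s, t) ∈ U →
      (γ t 0 - γ s 0) * (a2 s + a2 t) - (γ t 1 - γ s 1) * (a1 s + a1 t) = 0 := by
    intro s t h
    obtain ⟨-, -, hE⟩ := hU' s t h
    change ((γ t 0 - γ s 0) * y1 s - (γ t 1 - γ s 1) * x1 s) ^ 3 * k t +
      ((γ t 0 - γ s 0) * y1 t - (γ t 1 - γ s 1) * x1 t) ^ 3 * k s = 0 at hE
    rw [ex, ey, ex, ey, ← hr3, ← hr3] at hE
    have hcube : ((γ t 0 - γ s 0) * a2 s - (γ t 1 - γ s 1) * a1 s) ^ 3 =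
        (-((γ t 0 - γ s 0) * a2 t - (γ t 1 - γ s 1) * a1 t)) ^ 3 := by
      apply mul_left_cancel₀ (pow_ne_zero 3 (mul_ne_zero (hr0 s) (hr0 t)))
      linear_combination hE
    have := (Odd.strictMono_pow (by decide : Odd 3)).injective hcube
    linear_combination this
  have hA : ∀ s t, (s, t) ∈ U → (γ t 0 - γ s 0) * a2 s - (γ t 1 - γ s 1) * a1 s ≠ 0 := by
    intro s t h h0
    refine (hU' s t h).1 ?_
    change (γ t 0 - γ s 0) * y1 s - (γ t 1 - γ s 1) * x1 s = 0
    rw [ex, ey]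
    linear_combination r s * h0
  obtain ⟨ca1, ca2⟩ := contDiff_of_chord_relation hUopen (contDiff_euclidean.1 hγ 0)
    (contDiff_euclidean.1 hγ 1) hx hy hF (fun s t h => (hU' s t h).2.1) hcover
  have hnorm : ∀ s, a1 s ^ 2 + a2 s ^ 2 ≠ 0 := fun s h => by
    have h1 : a1 s = 0 := by nlinarith [sq_nonneg (a1 s), sq_nonneg (a2 s)]
    have h2 : a2 s = 0 := by nlinarith [sq_nonneg (a1 s), sq_nonneg (a2 s)]
    rcases hreg' s with h0 | h0
    · exact h0 ((ex s).trans (by rw [h1, mul_zero]))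
    · exact h0 ((ey s).trans (by rw [h2, mul_zero]))
  have cr : ContDiff ℝ 1 r := by
    have e : r = fun s => (x1 s * a1 s + y1 s * a2 s) / (a1 s ^ 2 + a2 s ^ 2) := funext fun s => by
      rw [eq_div_iff (hnorm s), ex, ey]; ring
    rw [e]
    have c1 : ContDiff ℝ 1 a1 := ca1.of_le one_le_two
    have c2 : ContDiff ℝ 1 a2 := ca2.of_le one_le_two
    exact ((cx1.mul c1).add (cy1.mul c2)).div ((c1.pow 2).add (c2.pow 2)) hnorm
  have hr' : ∀ s, HasDerivAt r (deriv r s) s := fun s =>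
    (cr.differentiable one_ne_zero s).hasDerivAt
  have hquot : ∀ {f : ℝ → ℝ}, Differentiable ℝ f → ∀ s,
      HasDerivAt f (r s * (deriv f s / r s)) s := fun hf s =>
    (hf s).hasDerivAt.congr_deriv (mul_div_cancel₀ _ (hr0 s)).symm
  have hdiff : ∀ {f : ℝ → ℝ}, ContDiff ℝ 2 f → Differentiable ℝ fun s => deriv f s / r s :=
    fun hf => ((contDiff_succ_iff_deriv.1 hf).2.2.div cr hr0).differentiable one_ne_zero
  have ha1 := hquot (ca1.differentiable two_ne_zero)
  have ha2 := hquot (ca2.differentiable two_ne_zero)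
  have hb1 := hquot (hdiff ca1)
  have hb2 := hquot (hdiff ca2)
  set b1 : ℝ → ℝ := fun s => deriv a1 s / r s
  set b2 : ℝ → ℝ := fun s => deriv a2 s / r s
  have hab : ∀ s, a1 s * b2 s - a2 s * b1 s = 1 := fun s => by
    have h1 : x2 s = deriv r s * a1 s + r s * (r s * b1 s) :=
      (hx1 s).unique (((hr' s).mul (ha1 s)).congr_of_eventuallyEq (.of_forall ex))
    have h2 : y2 s = deriv r s * a2 s + r s * (r s * b2 s) :=
      (hy1 s).unique (((hr' s).mul (ha2 s)).congr_of_eventuallyEq (.of_forall ey))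
    have h3 : r s ^ 3 = x1 s * y2 s - y1 s * x2 s := hr3 s
    rw [ex, ey, h1, h2] at h3
    apply mul_left_cancel₀ (pow_ne_zero 3 (hr0 s))
    linear_combination -h3
  have hx' : ∀ s, HasDerivAt (fun s => γ s 0) (r s * a1 s) s := fun s =>
    (hx s).congr_deriv (ex s)
  have hy' : ∀ s, HasDerivAt (fun s => γ s 1) (r s * a2 s) s := fun s =>
    (hy s).congr_deriv (ey s)
  obtain ⟨μ, hμ⟩ := affine_curvature_const hUopen hr0 hx' hy' ha1 ha2 hb1 hb2 hab hF hA hcover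
  have hb1' : ∀ s, HasDerivAt b1 (r s * (-μ * a1 s)) s := fun s =>
    (hb1 s).congr_deriv (by rw [← (hμ s).1])
  have hb2' : ∀ s, HasDerivAt b2 (r s * (-μ * a2 s)) s := fun s =>
    (hb2 s).congr_deriv (by rw [← (hμ s).2])
  have pa1 : Function.Periodic a1 L := px1.div pr
  have pa2 : Function.Periodic a2 L := py1.div pr
  have pb1 : Function.Periodic b1 L :=
    (periodic_of_hasDerivAt pa1 fun s => (ca1.differentiable two_ne_zero s).hasDerivAt).div pr
  have pb2 : Function.Periodic b2 L :=
    (periodic_of_hasDerivAt pa2 fun s => (ca2.differentiable two_ne_zero s).hasDerivAt).div pr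
  exact range_eq_ellipse hL hr0 cr.continuous pr
    (affine_curvature_pos hL hr0 ha1 ha2 hb1' hb2' hab pa1 pa2 pb1 pb2)
    hx' hy' ha1 ha2 hb1' hb2' hab
end
end

section
/- Under the flotation setup with det(γ'(s), γ'(t(s))) ≠ 0 for all s, let z(s) = γ(s) + (det(c(s), γ'(t(s))) / det(γ'(s), γ'(t(s))))·γ'(s) be the intersection of the tangent lines to γ at the endpoints of the chord of flotation (z parametrizes the boundary of the dual body of illumination). Suppose the three curves r₁, r₂, z are pairwise homothetic; that is, there exist points z₁, z₂, z₃ ∈ ℝ² and real ratios λ₁, λ₂, λ₃ ∉ {0, 1} such that for all s: r₂(s) = z₁ + λ₁·(r₁(s) − z₁), z(s) = z₂ + λ₂·(r₁(s) − z₂), and z(s) = z₃ + λ₃·(r₂(s) − z₃). Then the image of γ is an ellipse. -/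
open Real MeasureTheory intervalIntegral

noncomputable section

/-- A function whose continuous derivative is bounded away from zero is onto. -/
lemma surjective_of_le_abs_deriv {f f' : ℝ → ℝ} (hf : ∀ s, HasDerivAt f (f' s) s)
    (hf' : Continuous f') {ε : ℝ} (hε : 0 < ε) (hle : ∀ s, ε ≤ |f' s|) :
    Function.Surjective f := by
  have increasing : ∀ {g g' : ℝ → ℝ}, (∀ s, HasDerivAt g (g' s) s) → (∀ s, ε ≤ g' s) →
      Function.Surjective g := by
    intro g g' hg hle
    have hcont : Continuous g := continuous_iff_continuousAt.2 fun s => (hg s).continuousAt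
    have hd : ∀ s, HasDerivAt (fun x => g x - ε * x) (g' s - ε) s := fun s => by
      simpa using (hg s).fun_sub ((hasDerivAt_id s).const_mul ε)
    have hmono : Monotone fun x => g x - ε * x :=
      monotone_of_deriv_nonneg (fun s => (hd s).differentiableAt) fun s => by
        rw [(hd s).deriv]; linarith [hle s]
    refine hcont.surjective ?_ ?_
    · refine Filter.tendsto_atTop_mono' _ ?_ (Filter.tendsto_atTop_add_const_left _ (g 0)
        (Filter.tendsto_id.const_mul_atTop hε))
      filter_upwards [Filter.eventually_ge_atTop 0] with x hx
      have := hmono hx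
      simp only [mul_zero, sub_zero, id] at this ⊢
      linarith
    · refine Filter.tendsto_atBot_mono' _ ?_ (Filter.tendsto_atBot_add_const_left _ (g 0)
        (Filter.tendsto_id.const_mul_atBot hε))
      filter_upwards [Filter.eventually_le_atBot 0] with x hx
      have := hmono hx
      simp only [mul_zero, sub_zero, id] at this ⊢
      linarith
  have hsign : (∀ s, 0 ≤ f' s) ∨ ∀ s, f' s ≤ 0 := by
    by_contra! h
    obtain ⟨⟨a, ha⟩, b, hb⟩ := h
    obtain ⟨c, hc⟩ := mem_range_of_exists_le_of_exists_ge hf' ⟨a, ha.le⟩ ⟨b, hb.le⟩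
    have := hle c
    rw [hc, abs_zero] at this
    linarith
  rcases hsign with h | h
  · exact increasing hf fun s => by simpa [abs_of_nonneg (h s)] using hle s
  · intro y
    obtain ⟨x, hx⟩ := increasing (fun s => (hf s).neg)
      (fun s => by simpa [abs_of_nonpos (h s)] using hle s) (-y)
    exact ⟨x, by simpa using hx⟩

lemma hasDerivAt_apply {f : ℝ → R2} {f' : R2} {s : ℝ} (h : HasDerivAt f f' s) (i : Fin 2) :
    HasDerivAt (fun x => f x i) (f' i) s :=
  (EuclideanSpace.proj (𝕜 := ℝ) i).hasFDerivAt.comp_hasDerivAt s h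

lemma abs_apply_le_norm (x : R2) (i : Fin 2) : |x i| ≤ ‖x‖ := by
  simpa using PiLp.norm_apply_le x i

/-- Differentiating the constancy of the area cut off by the chord from `γ s` to `γ (t s)`. -/
lemma deriv_mul_det2_of_area_const {γ : ℝ → R2} (hγ : ContDiff ℝ 1 γ) {t : ℝ → ℝ}
    (ht : Differentiable ℝ t) {δ : ℝ}
    (hA : ∀ s, (1/2) * ∫ u in s..t s, det2 (γ u - γ s) (deriv γ u) = δ) (s : ℝ) :
    deriv t s * det2 (γ (t s) - γ s) (deriv γ (t s)) = -det2 (γ (t s) - γ s) (deriv γ s) := by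
  have hd : ∀ s i, HasDerivAt (fun x => γ x i) (deriv γ s i) s := fun s i =>
    hasDerivAt_apply ((hγ.differentiable (by norm_num)) s).hasDerivAt i
  have hc : ∀ i, Continuous fun s => γ s i := fun i =>
    continuous_iff_continuousAt.2 fun s => (hd s i).continuousAt
  have hγ' : Continuous (deriv γ) := hγ.continuous_deriv le_rfl
  have hc' : ∀ i, Continuous fun s => deriv γ s i := fun i =>
    (EuclideanSpace.proj (𝕜 := ℝ) i).continuous.comp hγ'
  have hw : Continuous fun u => det2 (γ u) (deriv γ u) :=
    ((hc 0).mul (hc' 1)).sub ((hc 1).mul (hc' 0))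
  have hG : ∀ s, HasDerivAt (fun x => ∫ u in (0:ℝ)..x, det2 (γ u) (deriv γ u))
      (det2 (γ s) (deriv γ s)) s := fun s => hw.integral_hasStrictDerivAt 0 s |>.hasDerivAt
  have key : ∀ s, (∫ u in (0:ℝ)..t s, det2 (γ u) (deriv γ u))
      - (∫ u in (0:ℝ)..s, det2 (γ u) (deriv γ u)) - (γ s 0 * γ (t s) 1 - γ s 1 * γ (t s) 0)
      = 2 * δ := by
    intro s
    rw [intervalIntegral.integral_interval_sub_left (hw.intervalIntegrable _ _)
      (hw.intervalIntegrable _ _), ← hA s]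
    have hi : ∀ i, ∫ u in s..t s, deriv γ u i = γ (t s) i - γ s i := fun i =>
      intervalIntegral.integral_eq_sub_of_hasDerivAt (fun u _ => hd u i)
        ((hc' i).intervalIntegrable _ _)
    have hsplit : (fun u => det2 (γ u - γ s) (deriv γ u)) = fun u => det2 (γ u) (deriv γ u)
        - (γ s 0 * deriv γ u 1 - γ s 1 * deriv γ u 0) := by
      funext u
      simp only [det2, PiLp.sub_apply]
      ring
    have hv : Continuous fun u => γ s 0 * deriv γ u 1 - γ s 1 * deriv γ u 0 :=
      ((hc' 1).const_mul _).sub ((hc' 0).const_mul _)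
    rw [hsplit, intervalIntegral.integral_sub (hw.intervalIntegrable _ _)
      (hv.intervalIntegrable _ _),
      intervalIntegral.integral_sub (((hc' 1).const_mul _).intervalIntegrable _ _)
      (((hc' 0).const_mul _).intervalIntegrable _ _), intervalIntegral.integral_const_mul,
      intervalIntegral.integral_const_mul, hi, hi]
    ring
  have htd := (ht s).hasDerivAt
  have hq : ∀ i, HasDerivAt (fun x => γ (t x) i) (deriv γ (t s) i * deriv t s) s := fun i =>
    (hd (t s) i).comp s htd
  have hder := (((hG (t s)).comp s htd).sub (hG s)).sub
    (((hd s 0).mul (hq 1)).sub ((hd s 1).mul (hq 0)))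
  have h0 := hder.unique ((hasDerivAt_const s (2 * δ)).congr_of_eventuallyEq
    (Filter.Eventually.of_forall key))
  simp only [det2, PiLp.sub_apply] at h0 ⊢
  linarith

/-- A bounded solution of `m' = g h`, `h' = -κ g m` with nonvanishing area and `g` bounded away
from zero has `κ > 0`. -/
lemma pos_of_bounded_solution {m h : ℝ → R2} {g : ℝ → ℝ} {κ ε C : ℝ} (hκ : κ ≠ 0)
    (hm : ∀ s, HasDerivAt m (g s • h s) s) (hh : ∀ s, HasDerivAt h (-(g s * κ) • m s) s)
    (hg : Continuous g) (hε : 0 < ε) (hle : ∀ s, ε ≤ |g s|) (hdet : det2 (m 0) (h 0) ≠ 0)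
    (hmC : ∀ s, ‖m s‖ ≤ C) (hhC : ∀ s, ‖h s‖ ≤ C) : 0 < κ := by
  by_contra! hκ'
  have hneg : 0 < -κ := neg_pos.2 (lt_of_le_of_ne hκ' hκ)
  have hm' : ∀ s i, HasDerivAt (fun x => m x i) (g s * h s i) s := fun s i => by
    simpa using hasDerivAt_apply (hm s) i
  have hh' : ∀ s i, HasDerivAt (fun x => h x i) (-(g s * κ) * m s i) s := fun s i => by
    simpa using hasDerivAt_apply (hh s) i
  have hconst : ∀ s, det2 (m s) (h s) = det2 (m 0) (h 0) := by
    have hd : ∀ s, HasDerivAt (fun x => det2 (m x) (h x)) 0 s := fun s => by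
      refine HasDerivAt.congr_deriv (((hm' s 0).mul (hh' s 1)).sub ((hm' s 1).mul (hh' s 0))) ?_
      ring
    exact fun s => is_const_of_deriv_eq_zero (fun s => (hd s).differentiableAt)
      (fun s => (hd s).deriv) s 0
  set d := |det2 (m 0) (h 0)| with hd
  have hdpos : 0 < d := abs_pos.2 hdet
  set e := min (-κ) 1 with he
  have hepos : 0 < e := lt_min hneg one_pos
  set E : ℝ → ℝ := fun s => h s 0 ^ 2 + h s 1 ^ 2 + -κ * (m s 0 ^ 2 + m s 1 ^ 2) with hE
  have hEle : ∀ s, 2 * e * d ≤ E s := by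
    intro s
    have h1 : 2 * d ≤ h s 0 ^ 2 + h s 1 ^ 2 + (m s 0 ^ 2 + m s 1 ^ 2) := by
      rw [hd, ← hconst s, det2]
      rcases abs_cases (m s 0 * h s 1 - m s 1 * h s 0) with ⟨h', _⟩ | ⟨h', _⟩ <;> rw [h'] <;>
        nlinarith [sq_nonneg (m s 0 - h s 1), sq_nonneg (m s 1 + h s 0),
          sq_nonneg (m s 0 + h s 1), sq_nonneg (m s 1 - h s 0)]
    have h2 : e * (h s 0 ^ 2 + h s 1 ^ 2) ≤ 1 * (h s 0 ^ 2 + h s 1 ^ 2) :=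
      mul_le_mul_of_nonneg_right (min_le_right _ _) (by positivity)
    have h3 : e * (m s 0 ^ 2 + m s 1 ^ 2) ≤ -κ * (m s 0 ^ 2 + m s 1 ^ 2) :=
      mul_le_mul_of_nonneg_right (min_le_left _ _) (by positivity)
    have h4 := mul_le_mul_of_nonneg_left h1 hepos.le
    simp only [hE]
    linarith
  have hcm : ∀ i, Continuous fun s => m s i := fun i =>
    continuous_iff_continuousAt.2 fun s => (hm' s i).continuousAt
  have hch : ∀ i, Continuous fun s => h s i := fun i =>
    continuous_iff_continuousAt.2 fun s => (hh' s i).continuousAt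
  have hEc : Continuous fun s => g s * E s :=
    hg.mul ((((hch 0).pow 2).add ((hch 1).pow 2)).add
      ((((hcm 0).pow 2).add ((hcm 1).pow 2)).const_mul (-κ)))
  have hfd : ∀ s, HasDerivAt (fun x => m x 0 * h x 0 + m x 1 * h x 1) (g s * E s) s := fun s => by
    refine HasDerivAt.congr_deriv (((hm' s 0).mul (hh' s 0)).add ((hm' s 1).mul (hh' s 1))) ?_
    simp only [hE]
    ring
  obtain ⟨s, hs⟩ := surjective_of_le_abs_deriv hfd hEc (ε := ε * (2 * e * d)) (by positivity)
    (fun s => by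
      rw [abs_mul]
      exact mul_le_mul (hle s) ((hEle s).trans (le_abs_self _)) (by positivity) (abs_nonneg _))
    (2 * (C * C) + 1)
  have hb : ∀ i, m s i * h s i ≤ C * C := fun i => by
    refine (le_abs_self _).trans ?_
    rw [abs_mul]
    exact mul_le_mul ((abs_apply_le_norm _ _).trans (hmC s)) ((abs_apply_le_norm _ _).trans (hhC s))
      (abs_nonneg _) ((norm_nonneg _).trans (hmC s))
  simp only at hs
  linarith [hb 0, hb 1]

/-- The linear automorphism of the plane with linearly independent columns `u`, `v`. -/
lemma exists_linearEquiv_of_det2_ne_zero {u v : R2} (huv : det2 u v ≠ 0) :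
    ∃ T : R2 ≃ₗ[ℝ] R2, ∀ x, T x = x 0 • u + x 1 • v := by
  let f : R2 →ₗ[ℝ] R2 :=
    { toFun := fun x => x 0 • u + x 1 • v
      map_add' := fun x y => by simp only [PiLp.add_apply, add_smul]; abel
      map_smul' := fun c x => by simp [smul_smul] }
  have hf : Function.Injective f := by
    rw [injective_iff_map_eq_zero]
    intro x hx
    have h0 : x 0 * u 0 + x 1 * v 0 = 0 := congrArg (fun y : R2 => y 0) hx
    have h1 : x 0 * u 1 + x 1 * v 1 = 0 := congrArg (fun y : R2 => y 1) hx
    have hx0 : x 0 * det2 u v = 0 := by unfold det2; linear_combination v 1 * h0 - v 0 * h1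
    have hx1 : x 1 * det2 u v = 0 := by unfold det2; linear_combination u 0 * h1 - u 1 * h0
    ext i
    fin_cases i
    · simpa [huv] using hx0
    · simpa [huv] using hx1
  exact ⟨LinearEquiv.ofInjectiveEndo f hf, fun x => rfl⟩

lemma mem_sphere_iff_exists_angle (x : R2) :
    x ∈ Metric.sphere (0 : R2) 1 ↔ ∃ θ : ℝ, x = !₂[cos θ, sin θ] := by
  rw [mem_sphere_zero_iff_norm, EuclideanSpace.norm_eq, Real.sqrt_eq_one, Fin.sum_univ_two]
  constructor
  · intro hx
    have hz : ‖(⟨x 0, x 1⟩ : ℂ)‖ = 1 := by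
      rw [Complex.norm_def, Complex.normSq_mk, Real.sqrt_eq_one]
      simpa [sq] using hx
    refine ⟨Complex.arg ⟨x 0, x 1⟩, ?_⟩
    ext i
    fin_cases i
    · have := Complex.norm_mul_cos_arg (⟨x 0, x 1⟩ : ℂ)
      rw [hz, one_mul] at this
      simpa using this.symm
    · have := Complex.norm_mul_sin_arg (⟨x 0, x 1⟩ : ℂ)
      rw [hz, one_mul] at this
      simpa using this.symm
  · rintro ⟨θ, rfl⟩
    simp

/-- A solution of `m' = g h`, `h' = -κ g m` with `κ > 0` and `g` bounded away from zero: the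
curve `m - h` runs through a full ellipse. -/
lemma range_sub_eq_ellipse {m h : ℝ → R2} {g : ℝ → ℝ} {κ ε : ℝ} (hκ : 0 < κ)
    (hm : ∀ s, HasDerivAt m (g s • h s) s) (hh : ∀ s, HasDerivAt h (-(g s * κ) • m s) s)
    (hg : Continuous g) (hε : 0 < ε) (hle : ∀ s, ε ≤ |g s|) (hdet : det2 (m 0) (h 0) ≠ 0) :
    ∃ T : R2 ≃ₗ[ℝ] R2, Set.range (fun s => m s - h s) = T '' Metric.sphere (0 : R2) 1 := by
  obtain ⟨k, hk, rfl⟩ : ∃ k : ℝ, 0 < k ∧ κ = k ^ 2 :=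
    ⟨√κ, Real.sqrt_pos.2 hκ, (Real.sq_sqrt hκ.le).symm⟩
  set θ : ℝ → ℝ := fun s => ∫ u in (0:ℝ)..s, k * g u with hθdef
  have hkg : Continuous fun u => k * g u := hg.const_mul k
  have hθ : ∀ s, HasDerivAt θ (k * g s) s := fun s =>
    (hkg.integral_hasStrictDerivAt 0 s).hasDerivAt
  have hθ0 : θ 0 = 0 := by simp [hθdef]
  have hsurj : Function.Surjective θ :=
    surjective_of_le_abs_deriv hθ hkg (mul_pos hk hε) fun s => by
      rw [abs_mul, abs_of_pos hk]
      exact mul_le_mul_of_nonneg_left (hle s) hk.le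
  have hm' : ∀ s i, HasDerivAt (fun x => m x i) (g s * h s i) s := fun s i => by
    simpa using hasDerivAt_apply (hm s) i
  have hh' : ∀ s i, HasDerivAt (fun x => h x i) (-(g s * k ^ 2) * m s i) s := fun s i => by
    simpa using hasDerivAt_apply (hh s) i
  have hA : ∀ s i, k * m s i * cos (θ s) - h s i * sin (θ s) = k * m 0 i := by
    intro s i
    have hd : ∀ s, HasDerivAt (fun x => k * m x i * cos (θ x) - h x i * sin (θ x)) 0 s := fun s => by
      refine HasDerivAt.congr_deriv ((((hm' s i).const_mul k).mul (hθ s).cos).sub ((hh' s i).mul (hθ s).sin)) ?_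
      ring
    simpa [hθ0] using is_const_of_deriv_eq_zero (fun s => (hd s).differentiableAt)
      (fun s => (hd s).deriv) s 0
  have hB : ∀ s i, k * m s i * sin (θ s) + h s i * cos (θ s) = h 0 i := by
    intro s i
    have hd : ∀ s, HasDerivAt (fun x => k * m x i * sin (θ x) + h x i * cos (θ x)) 0 s := fun s => by
      refine HasDerivAt.congr_deriv ((((hm' s i).const_mul k).mul (hθ s).sin).add ((hh' s i).mul (hθ s).cos)) ?_
      ring
    simpa [hθ0] using is_const_of_deriv_eq_zero (fun s => (hd s).differentiableAt)
      (fun s => (hd s).deriv) s 0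
  obtain ⟨T, hT⟩ : ∃ T : R2 ≃ₗ[ℝ] R2, ∀ x,
      T x = x 0 • (m 0 - h 0) + x 1 • (k • m 0 + k⁻¹ • h 0) := by
    refine exists_linearEquiv_of_det2_ne_zero ?_
    have : det2 (m 0 - h 0) (k • m 0 + k⁻¹ • h 0) = (k + k⁻¹) * det2 (m 0) (h 0) := by
      simp only [det2, PiLp.sub_apply, PiLp.add_apply, PiLp.smul_apply, smul_eq_mul]
      ring
    rw [this]
    exact mul_ne_zero (by positivity) hdet
  have hpar : ∀ s, m s - h s = T !₂[cos (θ s), sin (θ s)] := by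
    intro s
    rw [hT]
    ext i
    have h1 := sin_sq_add_cos_sq (θ s)
    simp only [PiLp.sub_apply, PiLp.add_apply, PiLp.smul_apply, smul_eq_mul]
    simp only [Matrix.cons_val_zero, Matrix.cons_val_one]
    rw [← hB s i, show m 0 i = k⁻¹ * (k * m 0 i) by field_simp, ← hA s i]
    field_simp
    linear_combination (h s i * k - k * m s i) * h1
  refine ⟨T, Set.Subset.antisymm ?_ ?_⟩
  · rintro _ ⟨s, rfl⟩
    exact ⟨_, (mem_sphere_iff_exists_angle _).2 ⟨θ s, rfl⟩, (hpar s).symm⟩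
  · rintro _ ⟨x, hx, rfl⟩
    obtain ⟨φ, rfl⟩ := (mem_sphere_iff_exists_angle x).1 hx
    obtain ⟨s, rfl⟩ := hsurj φ
    exact ⟨s, hpar s⟩

/-- The velocity of a regular periodic `C¹` curve is bounded away from zero. -/
lemma exists_pos_le_norm_deriv {γ : ℝ → R2} (hγ : ContDiff ℝ 1 γ) {L : ℝ} (hL : 0 < L)
    (hper : ∀ s, γ (s + L) = γ s) (hreg : ∀ s, deriv γ s ≠ 0) :
    ∃ ε > 0, ∀ s, ε ≤ ‖deriv γ s‖ := by
  have hper' : Function.Periodic (fun s => ‖deriv γ s‖) L := fun s => by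
    have : deriv (fun x => γ (x + L)) s = deriv γ (s + L) := deriv_comp_add_const ..
    simp only [← this, hper]
  obtain ⟨x, _, hx⟩ := isCompact_Icc.exists_isMinOn (Set.nonempty_Icc.2 hL.le)
    (hγ.continuous_deriv le_rfl).norm.continuousOn
  refine ⟨_, norm_pos_iff.2 (hreg x), fun s => ?_⟩
  obtain ⟨y, hy, hsy⟩ := hper'.exists_mem_Ico₀ hL s
  exact (hx (Set.Ico_subset_Icc_self hy)).trans hsy.ge

/-- the weak homothety conjecture — if the flotation curve, the buoyancy
curve and the dual illumination curve are pairwise homothetic, then `K` is an ellipse. -/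
theorem stmt15
    (γ : ℝ → R2) (L : ℝ) (hL : 0 < L)
    (hγ : ContDiff ℝ 2 γ)
    (hper : ∀ s, γ (s + L) = γ s)
    (hreg : ∀ s, deriv γ s ≠ 0)
    (hinj : Set.InjOn γ (Set.Ico 0 L))
    (hor : 0 < ∫ s in (0:ℝ)..L, det2 (γ s) (deriv γ s))
    (K : Set R2) (hKconv : Convex ℝ K) (hKcomp : IsCompact K)
    (hKint : (interior K).Nonempty) (hKbd : frontier K = Set.range γ)
    (δ : ℝ) (hδ0 : 0 < δ) (hδK : δ < (volume K).toReal)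
    (t : ℝ → ℝ) (ht : ContDiff ℝ 1 t)
    (htrange : ∀ s, s < t s ∧ t s < s + L)
    (hA : ∀ s, (1/2) * ∫ u in s..t s, det2 (γ u - γ s) (deriv γ u) = δ)
    (hc1 : ∀ s, det2 (γ (t s) - γ s) (deriv γ s) ≠ 0)
    (hc2 : ∀ s, det2 (γ (t s) - γ s) (deriv γ (t s)) ≠ 0)
    (hpar : ∀ s, det2 (deriv γ s) (deriv γ (t s)) ≠ 0)
    (z₁ z₂ z₃ : R2) (lam₁ lam₂ lam₃ : ℝ)
    (h₁0 : lam₁ ≠ 0) (h₁1 : lam₁ ≠ 1)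
    (h₂0 : lam₂ ≠ 0) (h₂1 : lam₂ ≠ 1)
    (h₃0 : lam₃ ≠ 0) (h₃1 : lam₃ ≠ 1)
    (hhom₁ : ∀ s, buoyCurve γ t δ s = z₁ + lam₁ • (flotCurve γ t s - z₁))
    (hhom₂ : ∀ s, tangentPole γ t s = z₂ + lam₂ • (flotCurve γ t s - z₂))
    (hhom₃ : ∀ s, tangentPole γ t s = z₃ + lam₃ • (buoyCurve γ t δ s - z₃)) :
    ∃ (T : R2 ≃ₗ[ℝ] R2) (b : R2),
      Set.range γ = (fun x => T x + b) '' Metric.sphere (0:R2) 1 := by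
  have hγ1 : ContDiff ℝ 1 γ := hγ.of_le (by norm_num)
  have htd : Differentiable ℝ t := ht.differentiable (by norm_num)
  have hγd : ∀ s, HasDerivAt γ (deriv γ s) s := fun s =>
    ((hγ1.differentiable (by norm_num)) s).hasDerivAt
  have harea := deriv_mul_det2_of_area_const hγ1 htd hA
  set g : ℝ → ℝ := fun s =>
    det2 (deriv γ s) (deriv γ (t s)) / det2 (γ (t s) - γ s) (deriv γ (t s)) with hgdef
  have hgc : Continuous g := by
    have hcoord : ∀ {f : ℝ → R2}, Continuous f → ∀ i, Continuous fun s => f s i := fun hf i =>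
      (EuclideanSpace.proj (𝕜 := ℝ) i).continuous.comp hf
    have hdet : ∀ {f₁ f₂ : ℝ → R2}, Continuous f₁ → Continuous f₂ →
        Continuous fun s => det2 (f₁ s) (f₂ s) := fun h₁ h₂ =>
      ((hcoord h₁ 0).mul (hcoord h₂ 1)).sub ((hcoord h₁ 1).mul (hcoord h₂ 0))
    have hγ' := hγ1.continuous_deriv le_rfl
    exact (hdet hγ' (hγ'.comp ht.continuous)).div
      (hdet ((hγ1.continuous.comp ht.continuous).sub hγ1.continuous) (hγ'.comp ht.continuous)) hc2
  have hpole : ∀ s, deriv γ s = g s • (tangentPole γ t s - γ s) := fun s => by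
    have h1 := hpar s
    have h2 := hc2 s
    rw [tangentPole, add_sub_cancel_left, smul_smul, hgdef]
    simp only
    rw [div_mul_div_cancel₀ h2, div_self h1, one_smul]
  have hsum : ∀ s, deriv γ s + deriv t s • deriv γ (t s) = g s • (γ (t s) - γ s) := fun s => by
    have h2 := hc2 s
    have h3 := harea s
    have ht' : deriv t s = -det2 (γ (t s) - γ s) (deriv γ s) /
        det2 (γ (t s) - γ s) (deriv γ (t s)) := by
      rw [eq_div_iff h2, h3]
    ext i
    simp only [PiLp.add_apply, PiLp.smul_apply, smul_eq_mul, hgdef, ht']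
    field_simp
    fin_cases i <;> simp [det2] <;> ring
  set m : ℝ → R2 := fun s => flotCurve γ t s - z₂ with hmdef
  set h : ℝ → R2 := fun s => ((1:ℝ)/2) • (γ (t s) - γ s) with hhdef
  have hqd : ∀ s, HasDerivAt (fun x => γ (t x)) (deriv t s • deriv γ (t s)) s := fun s =>
    (hγd (t s)).scomp s (htd s).hasDerivAt
  have hmd : ∀ s, HasDerivAt m (g s • h s) s := fun s => by
    refine HasDerivAt.congr_deriv ((((hγd s).add (hqd s)).const_smul ((1:ℝ)/2)).sub_const z₂) ?_
    rw [hsum, smul_comm]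
  have hhd : ∀ s, HasDerivAt h (-(g s * (lam₂ - 1)) • m s) s := fun s => by
    refine HasDerivAt.congr_deriv (((hqd s).sub (hγd s)).const_smul ((1:ℝ)/2)) ?_
    have e1 : deriv t s • deriv γ (t s) - deriv γ s =
        g s • (γ (t s) - γ s) - (2:ℝ) • (g s • (tangentPole γ t s - γ s)) := by
      rw [← hsum, ← hpole]
      module
    rw [e1, hhom₂, hmdef]
    simp only [flotCurve]
    module
  have hγh : ∀ s, γ s = m s - h s + z₂ := fun s => by
    simp only [hmdef, hhdef, flotCurve]
    module
  have hdet : det2 (m 0) (h 0) ≠ 0 := by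
    intro h0
    apply hc1 0
    rw [hpole, hhom₂]
    have : det2 (γ (t 0) - γ 0) (g 0 • (z₂ + lam₂ • (flotCurve γ t 0 - z₂) - γ 0)) =
        -2 * g 0 * (lam₂ - 1) * det2 (m 0) (h 0) := by
      simp [det2, hmdef, hhdef, flotCurve]
      ring
    rw [this, h0, mul_zero]
  obtain ⟨C, hC⟩ : ∃ C, ∀ s, ‖γ s‖ ≤ C := by
    obtain ⟨C, hC⟩ := hKcomp.isBounded.exists_norm_le
    refine ⟨C, fun s => hC _ (hKcomp.isClosed.frontier_subset ?_)⟩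
    rw [hKbd]
    exact ⟨s, rfl⟩
  have hmC : ∀ s, ‖m s‖ ≤ C + ‖z₂‖ := fun s => by
    refine (norm_sub_le _ _).trans (add_le_add_left ?_ _)
    rw [flotCurve, norm_smul]
    have := norm_add_le (γ s) (γ (t s))
    norm_num
    linarith [hC s, hC (t s)]
  have hhC : ∀ s, ‖h s‖ ≤ C + ‖z₂‖ := fun s => by
    have := norm_sub_le (γ (t s)) (γ s)
    simp only [hhdef, norm_smul]
    norm_num
    linarith [hC s, hC (t s), norm_nonneg z₂]
  obtain ⟨η, hη, hηle⟩ := exists_pos_le_norm_deriv hγ1 hL hper hreg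
  obtain ⟨ε, hε, hle⟩ : ∃ ε > 0, ∀ s, ε ≤ |g s| := by
    set D := |lam₂ - 1| * (C + ‖z₂‖) + (C + ‖z₂‖) with hD
    have hbound : ∀ s, ‖tangentPole γ t s - γ s‖ ≤ D := fun s => by
      have e : tangentPole γ t s - γ s = (lam₂ - 1) • m s + h s := by
        rw [hhom₂, hγh s]
        simp only [hmdef]
        module
      rw [e]
      refine (norm_add_le _ _).trans (add_le_add ?_ (hhC s))
      rw [norm_smul, Real.norm_eq_abs]
      exact mul_le_mul_of_nonneg_left (hmC s) (abs_nonneg _)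
    have hmul : ∀ s, η ≤ |g s| * D := fun s => by
      have := hηle s
      rw [hpole, norm_smul, Real.norm_eq_abs] at this
      exact this.trans (mul_le_mul_of_nonneg_left (hbound s) (abs_nonneg _))
    have hDpos : 0 < D := by
      by_contra! hD'
      linarith [hmul 0, mul_nonpos_of_nonneg_of_nonpos (abs_nonneg (g 0)) hD']
    exact ⟨η / D, div_pos hη hDpos, fun s => (div_le_iff₀ hDpos).2 (hmul s)⟩
  have hκ : 0 < lam₂ - 1 :=
    pos_of_bounded_solution (sub_ne_zero.2 h₂1) hmd hhd hgc hε hle hdet hmC hhC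
  obtain ⟨T, hT⟩ := range_sub_eq_ellipse hκ hmd hhd hgc hε hle hdet
  refine ⟨T, z₂, ?_⟩
  rw [← Set.image_image (fun x => x + z₂) T, ← hT, ← Set.range_comp]
  exact congrArg Set.range (funext hγh)
end
end
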